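/- arXiv:2101.04058 — 5 statements merged into one kernel-verified Lean document; each statement's English description precedes it below -/
import Mathlib

section
/- For all integers n ≥ 0 and ℓ ≥ 1, PD_{2^ℓ}(n) ≡ a_{n,ℓ} (mod 2), where a_{n,ℓ} denotes the number of tuples (k_0, k_1, …, k_{ℓ-1}) of nonnegative integers such that n = Σ_{m=0}^{ℓ-1} 2^m k_m² and, for each m, either k_m = 0 or 3 does not divide k_m. -/
/-- `PD k n` is the number of partitions of `n` with designated summands whose parts are
not divisible by `k`: the sum over partitions of `n` with no part divisible by `k` of the
product of the multiplicities of the distinct part sizes. -/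
def PD (k n : ℕ) : ℕ :=
  ∑ p : n.Partition,
    if ∀ s ∈ p.parts, ¬ k ∣ s then ∏ s ∈ p.parts.toFinset, p.parts.count s else 0

section DesignatedSummands

open Finset PowerSeries

/-- Gaussian binomial coefficients, evaluated at `q`. -/
def gaussChoose {R : Type*} [CommRing R] (q : R) : ℕ → ℕ → R
  | _, 0 => 1
  | 0, _ + 1 => 0
  | n + 1, k + 1 => gaussChoose q n k + q ^ (k + 1) * gaussChoose q n (k + 1)

/-- The finite `q`-Pochhammer product `(1 - q) ⋯ (1 - q ^ n)`. -/
def qFactorial {R : Type*} [CommRing R] (q : R) (n : ℕ) : R :=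
  ∏ i ∈ range n, (1 - q ^ (i + 1))

section GaussChoose

variable {R : Type*} [CommRing R] (q : R)

@[simp]
theorem gaussChoose_zero_right (n : ℕ) : gaussChoose q n 0 = 1 := by
  cases n <;> rfl

theorem gaussChoose_succ_succ (n k : ℕ) :
    gaussChoose q (n + 1) (k + 1) =
      gaussChoose q n k + q ^ (k + 1) * gaussChoose q n (k + 1) := rfl

theorem gaussChoose_eq_zero_of_lt {n k : ℕ} (h : n < k) : gaussChoose q n k = 0 := by
  induction n generalizing k with
  | zero => cases k with
    | zero => omega
    | succ k => rfl
  | succ n ih => cases k with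
    | zero => omega
    | succ k => rw [gaussChoose_succ_succ, ih (by omega), ih (by omega)]; ring

theorem qFactorial_succ (n : ℕ) : qFactorial q (n + 1) = qFactorial q n * (1 - q ^ (n + 1)) :=
  prod_range_succ _ _

@[simp]
theorem qFactorial_zero : qFactorial q 0 = 1 := rfl

theorem gaussChoose_mul_qFactorial_mul_qFactorial (m k : ℕ) :
    gaussChoose q (m + k) k * (qFactorial q k * qFactorial q m) = qFactorial q (m + k) := by
  induction k generalizing m with
  | zero => simp
  | succ k ihk =>
    induction m with
    | zero =>
      have h := ihk 0
      rw [zero_add] at h ⊢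
      rw [gaussChoose_succ_succ, gaussChoose_eq_zero_of_lt q k.lt_succ_self, qFactorial_succ]
      linear_combination (1 - q ^ (k + 1)) * h
    | succ m ihm =>
      have h := ihk (m + 1)
      have e : m + (k + 1) = m + 1 + k := by omega
      rw [e] at ihm
      rw [show m + 1 + (k + 1) = (m + 1 + k) + 1 by omega, gaussChoose_succ_succ,
        qFactorial_succ q (m + 1 + k)]
      rw [qFactorial_succ q k] at ihm ⊢
      rw [qFactorial_succ q m] at h ⊢
      linear_combination (1 - q ^ (k + 1)) * h + q ^ (k + 1) * (1 - q ^ (m + 1)) * ihm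

/-- Rothe's identity (the `q`-binomial theorem), in homogeneous form. -/
theorem prod_add_mul_pow_eq_sum_gaussChoose (y z : R) (m : ℕ) :
    ∏ i ∈ range m, (y + z * q ^ i) =
      ∑ k ∈ range (m + 1), gaussChoose q m k * q ^ k.choose 2 * z ^ k * y ^ (m - k) := by
  induction m generalizing z with
  | zero => simp
  | succ m ih =>
    have hshift : ∏ i ∈ range m, (y + z * q ^ (i + 1)) =
        ∑ k ∈ range (m + 1), gaussChoose q m k * q ^ k.choose 2 * (z * q) ^ k * y ^ (m - k) := by
      rw [← ih]
      exact prod_congr rfl fun i _ ↦ by ring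
    have hy : y * ∑ k ∈ range (m + 1),
          gaussChoose q m k * q ^ k.choose 2 * (z * q) ^ k * y ^ (m - k) =
        ∑ k ∈ range (m + 1), gaussChoose q m (k + 1) * q ^ (k + 1).choose 2 * (z * q) ^ (k + 1) *
          y ^ (m - k) + y ^ (m + 1) := by
      rw [sum_range_succ', sum_range_succ, gaussChoose_eq_zero_of_lt q m.lt_succ_self, mul_add,
        mul_sum]
      congr 1
      · simp only [zero_mul, add_zero]
        refine sum_congr rfl fun k hk ↦ ?_
        rw [show m - k = (m - (k + 1)) + 1 by have := mem_range.1 hk; omega]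
        ring
      · simp [pow_succ']
    rw [prod_range_succ', hshift, sum_range_succ' _ (m + 1), mul_comm, pow_zero, mul_one, add_mul,
      hy, mul_sum, add_right_comm, ← sum_add_distrib]
    congr 1
    · refine sum_congr rfl fun k _ ↦ ?_
      rw [gaussChoose_succ_succ, Nat.choose_succ_succ' k 1, Nat.choose_one_right,
        Nat.add_sub_add_right]
      ring
    · simp

end GaussChoose

theorem sum_range_two_mul_add_one {M : Type*} [AddCommMonoid M] (F : ℕ → M) (n : ℕ) :
    ∑ k ∈ range (2 * n + 1), F k =
      F n + ∑ j ∈ range n, (F (n + (j + 1)) + F (n - (j + 1))) := by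
  rw [show 2 * n + 1 = n + (n + 1) by omega, sum_range_add, sum_range_succ', sum_add_distrib,
    ← sum_range_reflect]
  simp only [Nat.sub_sub, add_comm 1, add_zero]
  abel

theorem add_choose_two (m n : ℕ) : (m + n).choose 2 = m.choose 2 + n.choose 2 + m * n := by
  induction n with
  | zero => simp
  | succ n ih =>
    rw [← add_assoc, Nat.choose_succ_succ' (m + n) 1, ih, Nat.choose_succ_succ' n 1]
    simp only [Nat.choose_one_right]
    ring

theorem two_mul_choose_two_add (n : ℕ) : 2 * n.choose 2 + n = n * n := by
  induction n with
  | zero => rfl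
  | succ n ih =>
    rw [Nat.choose_succ_succ' n 1, Nat.choose_one_right]
    linarith

/-- The exponent of `X` in the `j`-th term of the theta series with parameters `a`, `b`. -/
def thetaExp (a b j : ℕ) : ℕ := a * (j + 1).choose 2 + b * j.choose 2

/-- The symmetric partial sums of Ramanujan's theta series `f(X ^ a, X ^ b)`. -/
noncomputable def thetaSum (R : Type*) [CommRing R] (a b n : ℕ) : R⟦X⟧ :=
  1 + ∑ j ∈ range n, (X ^ thetaExp a b (j + 1) + X ^ thetaExp b a (j + 1))

/-- The partial products of `∏ (1 + X ^ ((a + b) i + a)) (1 + X ^ ((a + b) i + b))`. -/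
noncomputable def thetaProd (R : Type*) [CommRing R] (a b n : ℕ) : R⟦X⟧ :=
  ∏ i ∈ range n, ((1 + X ^ ((a + b) * i + a)) * (1 + X ^ ((a + b) * i + b)))

section Theta

variable {R : Type*} [CommRing R]

theorem thetaProd_eq_sum_gaussChoose (a b n : ℕ) :
    thetaProd R a b n = gaussChoose (X ^ (a + b)) (2 * n) n +
      ∑ j ∈ range n, (gaussChoose (X ^ (a + b)) (2 * n) (n + (j + 1)) * X ^ thetaExp a b (j + 1) +
        gaussChoose (X ^ (a + b)) (2 * n) (n - (j + 1)) * X ^ thetaExp b a (j + 1)) := by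
  refine X_pow_mul_cancel (k := a * n + (a + b) * (n.choose 2 + n * n)) ?_
  have hrothe := prod_add_mul_pow_eq_sum_gaussChoose (X ^ (a + b) : R⟦X⟧)
    (X ^ ((a + b) * n)) (X ^ a) (2 * n)
  rw [sum_range_two_mul_add_one, two_mul, prod_range_add] at hrothe
  have hlow : ∏ i ∈ range n, (X ^ ((a + b) * n) + X ^ a * (X ^ (a + b)) ^ i : R⟦X⟧) =
      X ^ (a * n + (a + b) * n.choose 2) * ∏ i ∈ range n, (1 + X ^ ((a + b) * i + b)) := by
    have hexp : a * n + (a + b) * n.choose 2 = ∑ i ∈ range n, (a + (a + b) * i) := by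
      rw [sum_add_distrib, ← mul_sum, sum_range_id, Nat.choose_two_right]
      simp [mul_comm]
    rw [← prod_range_reflect (fun i ↦ (1 + X ^ ((a + b) * i + b) : R⟦X⟧)), hexp,
      ← prod_pow_eq_pow_sum, ← prod_mul_distrib]
    refine prod_congr rfl fun i hi ↦ ?_
    obtain ⟨t, rfl⟩ : ∃ t, n = i + 1 + t := ⟨n - (i + 1), by have := mem_range.1 hi; omega⟩
    rw [show i + 1 + t - 1 - i = t by omega]
    ring
  have hhigh : ∏ i ∈ range n, (X ^ ((a + b) * n) + X ^ a * (X ^ (a + b)) ^ (n + i) : R⟦X⟧) =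
      X ^ ((a + b) * (n * n)) * ∏ i ∈ range n, (1 + X ^ ((a + b) * i + a)) := by
    have hpow : (X ^ ((a + b) * (n * n)) : R⟦X⟧) = ∏ _i ∈ range n, X ^ ((a + b) * n) := by
      rw [prod_const, card_range]
      ring
    rw [hpow, ← prod_mul_distrib]
    exact prod_congr rfl fun i _ ↦ by ring
  rw [hlow, hhigh, ← two_mul] at hrothe
  have hcenter : (X ^ (a + b)) ^ n.choose 2 * (X ^ a) ^ n * (X ^ ((a + b) * n)) ^ (2 * n - n) =
      (X ^ (a * n + (a + b) * (n.choose 2 + n * n)) : R⟦X⟧) := by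
    rw [show 2 * n - n = n by omega]
    ring
  have hright (j : ℕ) (hj : j ≤ n) : (X ^ (a + b)) ^ (n + j).choose 2 * (X ^ a) ^ (n + j) *
      (X ^ ((a + b) * n)) ^ (2 * n - (n + j)) =
      (X ^ (a * n + (a + b) * (n.choose 2 + n * n)) * X ^ thetaExp a b j : R⟦X⟧) := by
    obtain ⟨t, rfl⟩ := Nat.exists_eq_add_of_le hj
    rw [show 2 * (j + t) - (j + t + j) = t by omega]
    simp only [thetaExp, add_choose_two, ← pow_mul, ← pow_add]
    congr 1
    simp
    ring
  have hleft (j : ℕ) (hj : j ≤ n) : (X ^ (a + b)) ^ (n - j).choose 2 * (X ^ a) ^ (n - j) *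
      (X ^ ((a + b) * n)) ^ (2 * n - (n - j)) =
      (X ^ (a * n + (a + b) * (n.choose 2 + n * n)) * X ^ thetaExp b a j : R⟦X⟧) := by
    obtain ⟨t, rfl⟩ := Nat.exists_eq_add_of_le hj
    rw [show 2 * (j + t) - (j + t - j) = 2 * j + t by omega, show j + t - j = t by omega]
    simp only [thetaExp, add_choose_two, ← pow_mul, ← pow_add]
    congr 1
    simp
    linarith [congrArg ((a + b) * ·) (two_mul_choose_two_add j)]
  calc _ = _ := by
        rw [thetaProd, prod_mul_distrib]
        ring
    _ = _ := hrothe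
    _ = _ := by
        rw [mul_add, mul_sum, mul_assoc, mul_assoc, ← mul_assoc (_ ^ _), hcenter, mul_comm]
        congr 1
        refine sum_congr rfl fun j hj ↦ ?_
        have hj' : j + 1 ≤ n := mem_range.1 hj
        linear_combination gaussChoose (X ^ (a + b)) (2 * n) (n + (j + 1)) * hright _ hj' +
          gaussChoose (X ^ (a + b)) (2 * n) (n - (j + 1)) * hleft _ hj'

theorem constantCoeff_qFactorial {d : ℕ} (hd : d ≠ 0) (n : ℕ) :
    constantCoeff (qFactorial (X ^ d : R⟦X⟧) n) = 1 := by
  simp [qFactorial, map_prod, hd]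

theorem isUnit_qFactorial {d : ℕ} (hd : d ≠ 0) (n : ℕ) :
    IsUnit (qFactorial (X ^ d : R⟦X⟧) n) := by
  simp [isUnit_iff_constantCoeff, constantCoeff_qFactorial hd]

theorem dvd_qFactorial_add_sub (q : R) (m k : ℕ) :
    q ^ (m + 1) ∣ qFactorial q (m + k) - qFactorial q m := by
  induction k with
  | zero => simp
  | succ k ih =>
    rw [← add_assoc, qFactorial_succ]
    obtain ⟨c, hc⟩ := ih
    exact ⟨c - qFactorial q (m + k) * q ^ k, by linear_combination hc⟩

theorem dvd_qFactorial_mul_gaussChoose_sub_one {d : ℕ} (hd : d ≠ 0) {n k m : ℕ}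
    (hkm : k + m = 2 * n) {s : ℕ} (hsk : s ≤ k) (hsm : s ≤ m) :
    (X ^ d : R⟦X⟧) ^ (s + 1) ∣
      qFactorial (X ^ d) n * gaussChoose (X ^ d) (2 * n) k - 1 := by
  have hfac (t : ℕ) (ht : s ≤ t) :
      Ideal.Quotient.mk (Ideal.span {(X ^ d : R⟦X⟧) ^ (s + 1)}) (qFactorial (X ^ d) t) =
      Ideal.Quotient.mk _ (qFactorial (X ^ d) s) := by
    obtain ⟨r, rfl⟩ := Nat.exists_eq_add_of_le ht
    rw [Ideal.Quotient.eq, Ideal.mem_span_singleton]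
    exact dvd_qFactorial_add_sub _ _ _
  have hu := ((isUnit_qFactorial (R := R) hd s).map
    (Ideal.Quotient.mk (Ideal.span {(X ^ d : R⟦X⟧) ^ (s + 1)})))
  rw [← Ideal.mem_span_singleton, ← Ideal.Quotient.eq, map_mul, map_one]
  have h := congrArg (Ideal.Quotient.mk (Ideal.span {(X ^ d : R⟦X⟧) ^ (s + 1)}))
    (gaussChoose_mul_qFactorial_mul_qFactorial (X ^ d : R⟦X⟧) m k)
  rw [add_comm m k, hkm, map_mul, map_mul, hfac k hsk, hfac m hsm,
    hfac (2 * n) (by omega)] at h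
  rw [hfac n (by omega)]
  exact hu.mul_left_cancel (by linear_combination h)

theorem le_thetaExp {a : ℕ} (ha : a ≠ 0) (b j : ℕ) : j ≤ thetaExp a b j := by
  rw [thetaExp, Nat.choose_succ_succ' j 1, Nat.choose_one_right]
  nlinarith [Nat.pos_of_ne_zero ha]

/-- A truncated form of the Jacobi triple product identity. -/
theorem X_pow_dvd_qFactorial_mul_thetaProd_sub_thetaSum {a b : ℕ} (ha : a ≠ 0) (hb : b ≠ 0)
    (n : ℕ) :
    X ^ (n + 1) ∣ qFactorial (X ^ (a + b)) n * thetaProd R a b n - thetaSum R a b n := by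
  have key {k m s e : ℕ} (hkm : k + m = 2 * n) (hsk : s ≤ k) (hsm : s ≤ m) (he : n ≤ s + e) :
      X ^ (n + 1) ∣ (qFactorial (X ^ (a + b)) n * gaussChoose (X ^ (a + b)) (2 * n) k - 1) *
        (X ^ e : R⟦X⟧) := by
    have h1 := dvd_qFactorial_mul_gaussChoose_sub_one (R := R) (d := a + b) (by omega) hkm hsk hsm
    refine (pow_dvd_pow X (n := (a + b) * (s + 1) + e) ?_).trans ?_
    · nlinarith [Nat.pos_of_ne_zero ha]
    · rw [pow_add, pow_mul]
      exact mul_dvd_mul_right h1 _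
  have h0 := key (k := n) (m := n) (s := n) (e := 0) (by omega) le_rfl le_rfl le_rfl
  have hsum : qFactorial (X ^ (a + b)) n * thetaProd R a b n - thetaSum R a b n =
      (qFactorial (X ^ (a + b)) n * gaussChoose (X ^ (a + b)) (2 * n) n - 1) * X ^ 0 +
      ∑ j ∈ range n,
        ((qFactorial (X ^ (a + b)) n * gaussChoose (X ^ (a + b)) (2 * n) (n + (j + 1)) - 1) *
          X ^ thetaExp a b (j + 1) +
        (qFactorial (X ^ (a + b)) n * gaussChoose (X ^ (a + b)) (2 * n) (n - (j + 1)) - 1) *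
          X ^ thetaExp b a (j + 1)) := by
    rw [thetaProd_eq_sum_gaussChoose, thetaSum, mul_add, mul_sum, add_sub_add_comm,
      ← sum_sub_distrib]
    congr 1
    · ring
    · exact sum_congr rfl fun j _ ↦ by ring
  rw [hsum]
  refine dvd_add h0 (dvd_sum fun j hj ↦ ?_)
  have hj' : j + 1 ≤ n := mem_range.1 hj
  have e1 := le_thetaExp ha b (j + 1)
  have e2 := le_thetaExp hb a (j + 1)
  exact dvd_add
    (key (m := n - (j + 1)) (s := n - (j + 1)) (by omega) (by omega) le_rfl (by omega))
    (key (m := n + (j + 1)) (s := n - (j + 1)) (by omega) le_rfl (by omega) (by omega))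

end Theta

section ModTwo

open Filter Topology
open scoped PowerSeries.WithPiTopology

instance charP_powerSeries_zmod_two : CharP (ZMod 2)⟦X⟧ 2 :=
  charP_of_injective_ringHom (f := C) C_injective 2

theorem tendsto_zero_of_X_pow_dvd {u : ℕ → (ZMod 2)⟦X⟧} (h : ∀ n, X ^ n ∣ u n) :
    Tendsto u atTop (𝓝 0) := by
  refine (WithPiTopology.tendsto_iff_coeff_tendsto _ _ _ _).2 fun d ↦
    tendsto_atTop_of_eventually_const (i₀ := d + 1) fun n hn ↦ ?_
  rw [X_pow_dvd_iff.1 (h n) d hn, map_zero]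

theorem exists_tendsto_prod_one_add_X_pow {f : ℕ → ℕ} (hf : ∀ i, i ≤ f i) :
    ∃ L, Tendsto (fun n ↦ ∏ i ∈ range n, (1 + X ^ f i : (ZMod 2)⟦X⟧)) atTop (𝓝 L) := by
  refine ⟨_, (WithPiTopology.multipliable_one_add_of_tendsto_order_atTop_nhds_top _
    (f := fun i ↦ (X ^ f i : (ZMod 2)⟦X⟧)) ?_).tendsto_prod_tprod_nat⟩
  refine ENat.tendsto_nhds_top_iff_natCast_lt.2 fun n ↦ eventually_atTop.2 ⟨n + 1, fun m hm ↦ ?_⟩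
  rw [order_X_pow]
  exact_mod_cast hm.trans (hf m)

theorem exists_tendsto_qFactorial {d : ℕ} (hd : d ≠ 0) :
    ∃ L, Tendsto (qFactorial (X ^ d : (ZMod 2)⟦X⟧)) atTop (𝓝 L) := by
  obtain ⟨L, hL⟩ := exists_tendsto_prod_one_add_X_pow (f := fun i ↦ d * (i + 1))
    (fun i ↦ by nlinarith [Nat.pos_of_ne_zero hd])
  refine ⟨L, hL.congr fun n ↦ prod_congr rfl fun i _ ↦ ?_⟩
  rw [CharTwo.sub_eq_add, pow_mul]

theorem exists_tendsto_thetaProd {a b : ℕ} (ha : a ≠ 0) :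
    ∃ L, Tendsto (thetaProd (ZMod 2) a b) atTop (𝓝 L) := by
  obtain ⟨L, hL⟩ := exists_tendsto_prod_one_add_X_pow (f := fun i ↦ (a + b) * i + a)
    (fun i ↦ by nlinarith [Nat.pos_of_ne_zero ha])
  obtain ⟨L', hL'⟩ := exists_tendsto_prod_one_add_X_pow (f := fun i ↦ (a + b) * i + b)
    (fun i ↦ by nlinarith [Nat.pos_of_ne_zero ha])
  exact ⟨L * L', (hL.mul hL').congr fun n ↦ prod_mul_distrib.symm⟩

/-- The infinite product `∏ (1 - X ^ (d n))` over `n ≥ 1`, with coefficients modulo `2`. -/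
noncomputable def eulerSeries (d : ℕ) : (ZMod 2)⟦X⟧ :=
  limUnder atTop (qFactorial (X ^ d : (ZMod 2)⟦X⟧))

theorem tendsto_qFactorial {d : ℕ} (hd : d ≠ 0) :
    Tendsto (qFactorial (X ^ d : (ZMod 2)⟦X⟧)) atTop (𝓝 (eulerSeries d)) :=
  tendsto_nhds_limUnder (exists_tendsto_qFactorial hd)

theorem tendsto_qFactorial_mul {d c : ℕ} (hd : d ≠ 0) (hc : c ≠ 0) :
    Tendsto (fun n ↦ qFactorial (X ^ d : (ZMod 2)⟦X⟧) (c * n)) atTop (𝓝 (eulerSeries d)) :=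
  (tendsto_qFactorial hd).comp (tendsto_id.const_mul_atTop' (Nat.pos_of_ne_zero hc))

theorem eulerSeries_ne_zero {d : ℕ} (hd : d ≠ 0) : eulerSeries d ≠ 0 := by
  have h := ((WithPiTopology.continuous_constantCoeff (ZMod 2)).tendsto _).comp
    (tendsto_qFactorial hd)
  have h1 := tendsto_nhds_unique h (tendsto_const_nhds.congr fun n ↦
    (constantCoeff_qFactorial hd n).symm)
  rintro h0
  simp [h0] at h1

theorem eulerSeries_two_mul {d : ℕ} (hd : d ≠ 0) : eulerSeries (2 * d) = eulerSeries d ^ 2 := by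
  refine tendsto_nhds_unique (tendsto_qFactorial (by omega))
    (((tendsto_qFactorial hd).pow 2).congr fun n ↦ ?_)
  rw [qFactorial, qFactorial, ← prod_pow]
  refine prod_congr rfl fun i _ ↦ ?_
  rw [CharTwo.sub_eq_add, CharTwo.sub_eq_add, CharTwo.add_sq]
  ring

theorem eulerSeries_two_pow_mul {d : ℕ} (hd : d ≠ 0) (ℓ : ℕ) :
    eulerSeries (2 ^ ℓ * d) = eulerSeries d ^ 2 ^ ℓ := by
  induction ℓ with
  | zero => simp
  | succ ℓ ih =>
    rw [pow_succ', mul_assoc, eulerSeries_two_mul (by positivity), ih]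
    ring

theorem tendsto_thetaSum {a b : ℕ} (ha : a ≠ 0) (hb : b ≠ 0) {P : (ZMod 2)⟦X⟧}
    (hP : Tendsto (thetaProd (ZMod 2) a b) atTop (𝓝 P)) :
    Tendsto (thetaSum (ZMod 2) a b) atTop (𝓝 (eulerSeries (a + b) * P)) := by
  have h := ((tendsto_qFactorial (d := a + b) (by omega)).mul hP).sub
    (tendsto_zero_of_X_pow_dvd fun n ↦ (pow_dvd_pow X n.le_succ).trans
      (X_pow_dvd_qFactorial_mul_thetaProd_sub_thetaSum (R := ZMod 2) ha hb n))
  simpa using h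

theorem tendsto_thetaSum_one_two {d : ℕ} (hd : d ≠ 0) :
    Tendsto (thetaSum (ZMod 2) d (2 * d)) atTop (𝓝 (eulerSeries d)) := by
  obtain ⟨P, hP⟩ := exists_tendsto_thetaProd (a := d) (b := 2 * d) hd
  have h (n : ℕ) : thetaProd (ZMod 2) d (2 * d) n * qFactorial (X ^ (3 * d)) n =
      qFactorial (X ^ d) (3 * n) := by
    induction n with
    | zero => simp [thetaProd]
    | succ n ih =>
      rw [thetaProd, prod_range_succ, ← thetaProd, mul_add_one 3 n]
      simp only [qFactorial_succ, CharTwo.sub_eq_add] at ih ⊢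
      rw [← ih]
      ring
  have hlim := tendsto_nhds_unique ((hP.mul (tendsto_qFactorial (d := 3 * d) (by omega))).congr h)
    (tendsto_qFactorial_mul hd three_ne_zero)
  have := tendsto_thetaSum hd (by omega) hP
  rwa [show d + 2 * d = 3 * d by ring, mul_comm (eulerSeries _), hlim] at this

theorem tendsto_thetaSum_one_three {d : ℕ} (hd : d ≠ 0) :
    Tendsto (thetaSum (ZMod 2) d (3 * d)) atTop (𝓝 (eulerSeries d ^ 3)) := by
  obtain ⟨P, hP⟩ := exists_tendsto_thetaProd (a := d) (b := 3 * d) hd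
  have h (n : ℕ) : thetaProd (ZMod 2) d (3 * d) n * qFactorial (X ^ (2 * d)) (2 * n) =
      qFactorial (X ^ d) (4 * n) := by
    induction n with
    | zero => simp [thetaProd]
    | succ n ih =>
      rw [thetaProd, prod_range_succ, ← thetaProd, mul_add_one 4 n, mul_add_one 2 n]
      simp only [qFactorial_succ, CharTwo.sub_eq_add] at ih ⊢
      rw [← ih]
      ring
  have hlim := tendsto_nhds_unique
    ((hP.mul (tendsto_qFactorial_mul (d := 2 * d) (by omega) two_ne_zero)).congr h)
    (tendsto_qFactorial_mul hd four_ne_zero)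
  rw [eulerSeries_two_mul hd] at hlim
  convert! tendsto_thetaSum hd (by omega) hP using 2
  rw [show d + 3 * d = 2 * (2 * d) by ring, eulerSeries_two_mul (by omega),
    eulerSeries_two_mul hd]
  linear_combination -eulerSeries d ^ 2 * hlim

theorem exists_tendsto_thetaSum_one_five {d : ℕ} (hd : d ≠ 0) :
    ∃ L, Tendsto (thetaSum (ZMod 2) d (5 * d)) atTop (𝓝 L) ∧
      L * eulerSeries d = eulerSeries (3 * d) ^ 3 := by
  obtain ⟨P, hP⟩ := exists_tendsto_thetaProd (a := d) (b := 5 * d) hd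
  have h (n : ℕ) : thetaProd (ZMod 2) d (5 * d) n *
      (qFactorial (X ^ (2 * d)) (3 * n) * qFactorial (X ^ (3 * d)) (2 * n)) =
      qFactorial (X ^ d) (6 * n) * qFactorial (X ^ (2 * (3 * d))) n := by
    induction n with
    | zero => simp [thetaProd]
    | succ n ih =>
      rw [thetaProd, prod_range_succ, ← thetaProd, mul_add_one 6 n, mul_add_one 3 n,
        mul_add_one 2 n]
      simp only [qFactorial_succ, CharTwo.sub_eq_add] at ih ⊢
      linear_combination ((1 + X ^ (d * (6 * n + 1))) * (1 + X ^ (d * (6 * n + 2))) *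
        (1 + X ^ (d * (6 * n + 3))) * (1 + X ^ (d * (6 * n + 4))) *
        (1 + X ^ (d * (6 * n + 5))) * (1 + X ^ (d * (6 * n + 6))) ^ 2) * ih
  have hlim := tendsto_nhds_unique
    ((hP.mul ((tendsto_qFactorial_mul (d := 2 * d) (by omega) three_ne_zero).mul
      (tendsto_qFactorial_mul (d := 3 * d) (by omega) two_ne_zero))).congr h)
    ((tendsto_qFactorial_mul hd (by norm_num)).mul (tendsto_qFactorial (by omega)))
  rw [eulerSeries_two_mul hd, eulerSeries_two_mul (d := 3 * d) (by omega)] at hlim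
  refine ⟨_, tendsto_thetaSum hd (by omega) hP, ?_⟩
  rw [show d + 5 * d = 2 * (3 * d) by ring, eulerSeries_two_mul (by omega)]
  refine mul_left_cancel₀ (mul_ne_zero (eulerSeries_ne_zero hd)
    (eulerSeries_ne_zero (d := 3 * d) (by omega))) ?_
  linear_combination eulerSeries (3 * d) ^ 2 * hlim

theorem two_mul_thetaExp_add (a b j : ℕ) :
    2 * thetaExp a b j + b * j = (a + b) * (j * j) + a * j := by
  rw [thetaExp, ← two_mul_choose_two_add, Nat.choose_succ_succ' j 1, Nat.choose_one_right]
  ring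

theorem thetaSum_succ {R : Type*} [CommRing R] (a b n : ℕ) : thetaSum R a b (n + 1) =
    thetaSum R a b n + (X ^ thetaExp a b (n + 1) + X ^ thetaExp b a (n + 1)) := by
  rw [thetaSum, sum_range_succ, ← add_assoc, ← thetaSum]

theorem thetaSum_one_three_dissection {R : Type*} [CommRing R] (n : ℕ) :
    thetaSum R 1 3 (3 * n) + X * X ^ thetaExp 27 9 n =
      thetaSum R 3 6 (2 * n) + X * thetaSum R 9 27 n := by
  induction n with
  | zero => simp [thetaSum, thetaExp]
  | succ n ih =>
    have key {a b i c d j : ℕ} (h : thetaExp a b i = thetaExp c d j) :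
        (X ^ thetaExp a b i : R⟦X⟧) = X ^ thetaExp c d j := by rw [h]
    have key' {a b i c d j : ℕ} (h : thetaExp a b i = thetaExp c d j + 1) :
        (X ^ thetaExp a b i : R⟦X⟧) = X * X ^ thetaExp c d j := by rw [h, pow_succ']
    have h1 : (X ^ thetaExp 1 3 (3 * n + 1) : R⟦X⟧) = X * X ^ thetaExp 27 9 n :=
      key' (by linarith [two_mul_thetaExp_add 1 3 (3 * n + 1), two_mul_thetaExp_add 27 9 n])
    have h2 : (X ^ thetaExp 3 1 (3 * n + 1) : R⟦X⟧) = X ^ thetaExp 3 6 (2 * n + 1) :=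
      key (by linarith [two_mul_thetaExp_add 3 1 (3 * n + 1), two_mul_thetaExp_add 3 6 (2 * n + 1)])
    have h3 : (X ^ thetaExp 1 3 (3 * n + 2) : R⟦X⟧) = X ^ thetaExp 6 3 (2 * n + 1) :=
      key (by linarith [two_mul_thetaExp_add 1 3 (3 * n + 2), two_mul_thetaExp_add 6 3 (2 * n + 1)])
    have h4 : (X ^ thetaExp 3 1 (3 * n + 2) : R⟦X⟧) = X * X ^ thetaExp 9 27 (n + 1) :=
      key' (by linarith [two_mul_thetaExp_add 3 1 (3 * n + 2), two_mul_thetaExp_add 9 27 (n + 1)])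
    have h5 : (X ^ thetaExp 1 3 (3 * n + 3) : R⟦X⟧) = X ^ thetaExp 3 6 (2 * n + 2) :=
      key (by linarith [two_mul_thetaExp_add 1 3 (3 * n + 3), two_mul_thetaExp_add 3 6 (2 * n + 2)])
    have h6 : (X ^ thetaExp 3 1 (3 * n + 3) : R⟦X⟧) = X ^ thetaExp 6 3 (2 * n + 2) :=
      key (by linarith [two_mul_thetaExp_add 3 1 (3 * n + 3), two_mul_thetaExp_add 6 3 (2 * n + 2)])
    rw [mul_add_one 3 n, mul_add_one 2 n]
    simp only [thetaSum_succ, add_assoc, Nat.reduceAdd] at ih ⊢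
    linear_combination ih + h1 + h2 + h3 + h4 + h5 + h6

theorem eulerSeries_one_pow_three :
    eulerSeries 1 ^ 3 = eulerSeries 3 + X * eulerSeries 9 ^ 3 := by
  have h1 := (tendsto_thetaSum_one_three one_ne_zero).comp
    (tendsto_id.const_mul_atTop' (r := 3) (by norm_num))
  have h2 : Tendsto (fun n ↦ (X * X ^ thetaExp 27 9 n : (ZMod 2)⟦X⟧)) atTop (𝓝 0) :=
    tendsto_zero_of_X_pow_dvd fun n ↦
      dvd_mul_of_dvd_right (pow_dvd_pow X (le_thetaExp (by norm_num) 9 n)) X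
  have h3 := (tendsto_thetaSum_one_two three_ne_zero).comp
    (tendsto_id.const_mul_atTop' (r := 2) (by norm_num))
  have h4 := (tendsto_thetaSum_one_three (d := 9) (by norm_num)).const_mul X
  simpa using tendsto_nhds_unique ((h1.add h2).congr thetaSum_one_three_dissection) (h3.add h4)

/-- The truncated generating function of the squares `k ^ 2` with `k = 0` or `3 ∤ k`. -/
noncomputable def squareSum (n : ℕ) : (ZMod 2)⟦X⟧ :=
  ∑ k ∈ range n with k = 0 ∨ ¬ 3 ∣ k, X ^ k ^ 2

theorem squareSum_three_mul_add_two (n : ℕ) :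
    squareSum (3 * n + 2) = 1 + X * thetaSum (ZMod 2) 3 15 n := by
  induction n with
  | zero => simp [squareSum, sum_filter, sum_range_succ, thetaSum]
  | succ n ih =>
    have h1 : thetaExp 3 15 (n + 1) + 1 = (3 * n + 2) ^ 2 := by
      linarith [two_mul_thetaExp_add 3 15 (n + 1)]
    have h2 : thetaExp 15 3 (n + 1) + 1 = (3 * n + 4) ^ 2 := by
      linarith [two_mul_thetaExp_add 15 3 (n + 1)]
    rw [squareSum, sum_filter] at ih ⊢
    rw [mul_add_one 3 n, show 3 * n + 3 + 2 = 3 * n + 2 + 1 + 1 + 1 by ring, sum_range_succ,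
      sum_range_succ, sum_range_succ, ih, if_pos (by omega), if_neg (by omega),
      if_pos (by omega), thetaSum_succ, mul_add, mul_add, ← pow_succ', ← pow_succ', h1, h2]
    ring

theorem exists_tendsto_squareSum : ∃ S, Tendsto (fun n ↦ squareSum (3 * n + 2)) atTop (𝓝 S) ∧
    S * eulerSeries 3 = eulerSeries 1 ^ 3 := by
  obtain ⟨L, hL, hL'⟩ := exists_tendsto_thetaSum_one_five three_ne_zero
  refine ⟨1 + X * L, ((hL.const_mul X).const_add 1).congr fun n ↦
    (squareSum_three_mul_add_two n).symm, ?_⟩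
  rw [eulerSeries_one_pow_three]
  linear_combination X * hL'

/-- The generating function, modulo `2`, of the designated copies of a single part size `i + 1`. -/
noncomputable def partSeries (i : ℕ) : (ZMod 2)⟦X⟧ :=
  1 + ∑' j : ℕ, ((j + 1 : ℕ) : ZMod 2) • X ^ ((i + 1) * (j + 1))

theorem hasSum_succ_smul_pow_succ {x : (ZMod 2)⟦X⟧} (hx : constantCoeff (x ^ 2) = 0) :
    HasSum (fun j : ℕ ↦ ((j + 1 : ℕ) : ZMod 2) • x ^ (j + 1)) (x * ∑' k : ℕ, (x ^ 2) ^ k) := by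
  have heven : HasSum (fun k : ℕ ↦ ((2 * k + 1 : ℕ) : ZMod 2) • x ^ (2 * k + 1))
      (x * ∑' k : ℕ, (x ^ 2) ^ k) := by
    refine ((WithPiTopology.summable_pow_of_constantCoeff_eq_zero hx).hasSum.mul_left x).congr
      fun s ↦ sum_congr rfl fun k _ ↦ ?_
    beta_reduce
    rw [Nat.cast_add, Nat.cast_mul, ZMod.natCast_self, zero_mul, zero_add, Nat.cast_one, one_smul]
    ring
  have hodd : HasSum (fun k : ℕ ↦ ((2 * k + 1 + 1 : ℕ) : ZMod 2) • x ^ (2 * k + 1 + 1)) 0 := by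
    refine hasSum_zero.congr fun s ↦ sum_congr rfl fun k _ ↦ ?_
    beta_reduce
    rw [show 2 * k + 1 + 1 = 2 * (k + 1) by ring, Nat.cast_mul, ZMod.natCast_self, zero_mul,
      zero_smul]
  rw [← add_zero (x * _)]
  exact heven.even_add_odd hodd

theorem partSeries_mul_one_sub_pow_three (i : ℕ) :
    partSeries i * (1 - X ^ (i + 1)) ^ 3 = 1 - (X ^ 3) ^ (i + 1) := by
  have hx : constantCoeff ((X ^ (i + 1)) ^ 2 : (ZMod 2)⟦X⟧) = 0 := by simp
  have h := WithPiTopology.tsum_pow_mul_one_sub_of_constantCoeff_eq_zero hx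
  have h2 : (2 : (ZMod 2)⟦X⟧) = 0 := CharTwo.two_eq_zero
  rw [partSeries, pow_right_comm]
  simp only [pow_mul X (i + 1)]
  rw [(hasSum_succ_smul_pow_succ hx).tsum_eq]
  generalize (∑' k : ℕ, ((X ^ (i + 1) : (ZMod 2)⟦X⟧) ^ 2) ^ k) = t at h ⊢
  generalize (X ^ (i + 1) : (ZMod 2)⟦X⟧) = x at h ⊢
  linear_combination x * (1 - x) * h + ((x ^ 2 - x) * x * t * (1 - x) - x + x ^ 2) * h2

theorem prod_range_mul_ite_dvd {M : Type*} [CommMonoid M] {q : ℕ} (hq : q ≠ 0) (g : ℕ → M)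
    (n : ℕ) : ∏ i ∈ range (q * n), (if q ∣ i + 1 then g (i + 1) else 1) =
      ∏ i ∈ range n, g (q * (i + 1)) := by
  obtain ⟨r, rfl⟩ := Nat.exists_eq_succ_of_ne_zero hq
  induction n with
  | zero => simp
  | succ n ih =>
    rw [mul_add_one, prod_range_add, ih, prod_range_succ _ n, prod_range_succ _ r,
      prod_eq_one (s := range r), one_mul, if_pos]
    · rfl
    · exact ⟨n + 1, rfl⟩
    · intro i hi
      have := mem_range.1 hi
      refine if_neg fun h ↦ ?_
      rw [add_assoc, Nat.dvd_add_right (dvd_mul_right _ _)] at h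
      exact absurd (Nat.le_of_dvd i.succ_pos h) (by omega)

/-- The generating function of `PD k`, modulo `2`. -/
noncomputable def designatedSeries (k : ℕ) : (ZMod 2)⟦X⟧ :=
  PowerSeries.mk fun n ↦ (PD k n : ZMod 2)

theorem hasProd_designatedSeries (k : ℕ) :
    HasProd (fun i ↦ if k ∣ i + 1 then 1 else partSeries i) (designatedSeries k) := by
  convert! Nat.Partition.hasProd_genFun fun i c ↦ if k ∣ i then (0 : ZMod 2) else (c : ZMod 2)
    using 1
  · ext1 i
    split_ifs
    · simp
    · rfl
  · ext n
    simp only [designatedSeries, coeff_mk, Nat.Partition.coeff_genFun, PD, Nat.cast_sum]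
    refine sum_congr rfl fun p _ ↦ ?_
    rw [Finsupp.prod, Multiset.toFinsupp_support]
    simp only [Multiset.toFinsupp_apply]
    split_ifs with h
    · rw [Nat.cast_prod]
      exact prod_congr rfl fun s hs ↦ (if_neg (h s (Multiset.mem_toFinset.1 hs))).symm
    · push Not at h
      obtain ⟨s, hs, hks⟩ := h
      rw [Nat.cast_zero]
      exact (prod_eq_zero (i := s) (Multiset.mem_toFinset.2 hs) (by rw [if_pos hks])).symm

theorem designatedSeries_mul_eulerSeries {k : ℕ} (hk : k ≠ 0) :
    designatedSeries k * (eulerSeries (k * 3) * eulerSeries 1 ^ 3) =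
      eulerSeries 3 * eulerSeries k ^ 3 := by
  have h (n : ℕ) : (∏ i ∈ range (k * n), if k ∣ i + 1 then 1 else partSeries i) *
      (qFactorial (X ^ (k * 3)) n * qFactorial (X ^ 1) (k * n) ^ 3) =
      qFactorial (X ^ 3) (k * n) * qFactorial (X ^ k) n ^ 3 := by
    have h3 := prod_range_mul_ite_dvd hk (fun i ↦ (1 - (X ^ 3) ^ i : (ZMod 2)⟦X⟧)) n
    have h1 := prod_range_mul_ite_dvd hk (fun i ↦ ((1 - X ^ i) ^ 3 : (ZMod 2)⟦X⟧)) n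
    have e3 : qFactorial (X ^ (k * 3) : (ZMod 2)⟦X⟧) n =
        ∏ i ∈ range n, (1 - (X ^ 3) ^ (k * (i + 1))) := prod_congr rfl fun i _ ↦ by ring
    have e1 : qFactorial (X ^ k : (ZMod 2)⟦X⟧) n ^ 3 =
        ∏ i ∈ range n, (1 - X ^ (k * (i + 1))) ^ 3 := by
      rw [qFactorial, ← prod_pow]
      exact prod_congr rfl fun i _ ↦ by ring
    rw [e3, e1, ← h3, ← h1, qFactorial, qFactorial, ← prod_pow, ← prod_mul_distrib,
      ← prod_mul_distrib, ← prod_mul_distrib]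
    refine prod_congr rfl fun i _ ↦ ?_
    rw [pow_one]
    split_ifs
    · ring
    · linear_combination partSeries_mul_one_sub_pow_three i
  have hG := (hasProd_designatedSeries k).tendsto_prod_nat.comp
    (tendsto_id.const_mul_atTop' (Nat.pos_of_ne_zero hk))
  exact tendsto_nhds_unique
    ((hG.mul ((tendsto_qFactorial (d := k * 3) (by omega)).mul
      ((tendsto_qFactorial_mul one_ne_zero hk).pow 3))).congr h)
    ((tendsto_qFactorial_mul three_ne_zero hk).mul ((tendsto_qFactorial hk).pow 3))

theorem prod_pow_two_pow_mul_self {M : Type*} [CommMonoid M] (x : M) (ℓ : ℕ) :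
    (∏ m : Fin ℓ, x ^ 2 ^ (m : ℕ)) * x = x ^ 2 ^ ℓ := by
  induction ℓ with
  | zero => simp
  | succ ℓ ih =>
    rw [Fin.prod_univ_castSucc, mul_right_comm]
    simp only [Fin.val_castSucc, Fin.val_last, ih]
    rw [← pow_add, pow_succ, mul_two]

theorem designatedSeries_two_pow {S : (ZMod 2)⟦X⟧}
    (hS : S * eulerSeries 3 = eulerSeries 1 ^ 3) (ℓ : ℕ) :
    designatedSeries (2 ^ ℓ) = ∏ m : Fin ℓ, S ^ 2 ^ (m : ℕ) := by
  have h := designatedSeries_mul_eulerSeries (k := 2 ^ ℓ) (by positivity)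
  have h1 := eulerSeries_two_pow_mul one_ne_zero ℓ
  rw [mul_one] at h1
  rw [eulerSeries_two_pow_mul three_ne_zero, h1, pow_right_comm, ← hS, mul_pow,
    ← prod_pow_two_pow_mul_self S ℓ] at h
  have hS0 : S ≠ 0 := by
    rintro rfl
    exact pow_ne_zero 3 (eulerSeries_ne_zero one_ne_zero) (by rw [← hS, zero_mul])
  have h3 := eulerSeries_ne_zero three_ne_zero
  exact mul_right_cancel₀ (mul_ne_zero (mul_ne_zero (pow_ne_zero (2 ^ ℓ) h3) hS0) h3)
    (by linear_combination h)

theorem coeff_prod_squareSum_pow {n ℓ N : ℕ} (hN : n < N) :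
    coeff n (∏ m : Fin ℓ, squareSum N ^ 2 ^ (m : ℕ)) =
      (Nat.card {f : Fin ℓ → ℕ //
        n = ∑ m : Fin ℓ, 2 ^ (m : ℕ) * (f m) ^ 2 ∧ ∀ m, f m = 0 ∨ ¬ 3 ∣ f m} : ZMod 2) := by
  have : ExpChar (ZMod 2)⟦X⟧ 2 := .prime Nat.prime_two
  have hcard := Nat.subtype_card (p := fun f : Fin ℓ → ℕ ↦
      n = ∑ m : Fin ℓ, 2 ^ (m : ℕ) * (f m) ^ 2 ∧ ∀ m, f m = 0 ∨ ¬ 3 ∣ f m)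
    {f ∈ Fintype.piFinset fun _ : Fin ℓ ↦ {k ∈ range N | k = 0 ∨ ¬ 3 ∣ k} |
      n = ∑ m : Fin ℓ, 2 ^ (m : ℕ) * (f m) ^ 2} fun f ↦ ?_
  · simp only [squareSum, sum_pow_char_pow]
    rw [prod_univ_sum, map_sum, hcard, card_filter, Nat.cast_sum]
    refine sum_congr rfl fun f _ ↦ ?_
    have hf (m : Fin ℓ) : ((X ^ f m ^ 2) ^ 2 ^ (m : ℕ) : (ZMod 2)⟦X⟧) =
        X ^ (2 ^ (m : ℕ) * f m ^ 2) := by rw [← pow_mul, mul_comm]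
    simp only [hf, prod_pow_eq_pow_sum, coeff_X_pow, Nat.cast_ite, Nat.cast_one, Nat.cast_zero]
  · simp only [mem_filter, Fintype.mem_piFinset, mem_range]
    refine ⟨fun h ↦ ⟨h.2, fun m ↦ (h.1 m).2⟩, fun h ↦ ⟨fun m ↦ ⟨?_, h.2 m⟩, h.1⟩⟩
    have hle : 2 ^ (m : ℕ) * f m ^ 2 ≤ n := by
      rw [h.1]
      exact single_le_sum (f := fun m : Fin ℓ ↦ 2 ^ (m : ℕ) * f m ^ 2)
        (fun _ _ ↦ Nat.zero_le _) (mem_univ m)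
    calc f m ≤ f m ^ 2 := Nat.le_self_pow two_ne_zero _
      _ ≤ 2 ^ (m : ℕ) * f m ^ 2 := Nat.le_mul_of_pos_left _ (by positivity)
      _ < N := hle.trans_lt hN

end ModTwo

end DesignatedSummands

theorem stmt_0 (n ℓ : ℕ) (hℓ : 1 ≤ ℓ) :
    PD (2 ^ ℓ) n ≡
      Nat.card {f : Fin ℓ → ℕ //
        n = ∑ m : Fin ℓ, 2 ^ (m : ℕ) * (f m) ^ 2 ∧ ∀ m, f m = 0 ∨ ¬ 3 ∣ f m} [MOD 2] := by
  open scoped PowerSeries.WithPiTopology in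
  obtain ⟨S, hS, hSE⟩ := exists_tendsto_squareSum
  rw [← ZMod.natCast_eq_natCast_iff]
  have hlim := (PowerSeries.WithPiTopology.tendsto_iff_coeff_tendsto _ _ _ _).1
    (tendsto_finsetProd Finset.univ fun (m : Fin ℓ) _ ↦ hS.pow (2 ^ (m : ℕ))) n
  rw [← designatedSeries_two_pow hSE, designatedSeries, PowerSeries.coeff_mk] at hlim
  refine tendsto_nhds_unique hlim (tendsto_atTop_of_eventually_const (i₀ := n) fun N hN ↦ ?_)
  exact coeff_prod_squareSum_pow (by omega)
end

section
/- For all integers n ≥ 0 and every r ∈ {5, 7, 10, 13, 14, 15, 20, 21, 23, 26, 28, 29, 30, 31}, PD_4(32n + r) ≡ 0 (mod 2); moreover, for all integers n ≥ 0, PD_8(32n + 24) ≡ 0 (mod 2). -/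
namespace DesignatedSummands

open PowerSeries WithPiTopology Nat.Partition

/-- Modulo 2, the generating function of the number of `i` with `g i = n`. -/
noncomputable def fiberSeries {ι : Type*} (g : ι → ℕ) : (ZMod 2)⟦X⟧ :=
  .mk fun n ↦ (Nat.card {i // g i = n} : ZMod 2)

section FiberSeries

variable {ι κ : Type*}

theorem fiberSeries_congr (e : ι ≃ κ) {g : ι → ℕ} {h : κ → ℕ} (he : ∀ i, h (e i) = g i) :
    fiberSeries g = fiberSeries h := by
  ext n
  simp only [fiberSeries, coeff_mk]
  rw [Nat.card_congr (e.subtypeEquiv (q := fun j ↦ h j = n) fun i ↦ by rw [he i])]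

theorem coeff_fiberSeries_eq_zero {g : ι → ℕ} {n : ℕ} (h : ∀ i, g i ≠ n) :
    (fiberSeries g).coeff n = 0 := by
  have : IsEmpty {i // g i = n} := ⟨fun i ↦ h i i.2⟩
  simp [fiberSeries]

theorem expand_fiberSeries (d : ℕ) (hd : d ≠ 0) (g : ι → ℕ) :
    (fiberSeries g).expand d hd = fiberSeries (fun i ↦ d * g i) := by
  ext n
  rw [coeff_expand]
  split_ifs with h
  · obtain ⟨m, rfl⟩ := h
    simp [fiberSeries, Nat.mul_div_cancel_left m (Nat.pos_of_ne_zero hd), hd]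
  · refine (coeff_fiberSeries_eq_zero fun i hi ↦ h ⟨_, hi.symm⟩).symm

/-- The fibres of a sum of two functions of independent variables. -/
def fiberAddEquiv (g : ι → ℕ) (h : κ → ℕ) (n : ℕ) :
    {x : ι × κ // g x.1 + h x.2 = n} ≃
      Σ a : Finset.HasAntidiagonal.antidiagonal n, {i // g i = a.1.1} × {j // h j = a.1.2} where
  toFun x := ⟨⟨(g x.1.1, h x.1.2), by simpa using x.2⟩, ⟨x.1.1, rfl⟩, ⟨x.1.2, rfl⟩⟩
  invFun y := ⟨(y.2.1.1, y.2.2.1), by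
    rw [y.2.1.2, y.2.2.2]
    exact Finset.HasAntidiagonal.mem_antidiagonal.1 y.1.2⟩
  left_inv x := rfl
  right_inv := by
    rintro ⟨⟨⟨a, b⟩, hab⟩, ⟨i, hi⟩, ⟨j, hj⟩⟩
    dsimp only at hi hj
    subst hi hj
    rfl

theorem finite_fiber_add {g : ι → ℕ} {h : κ → ℕ} (hg : ∀ n, Finite {i // g i = n})
    (hh : ∀ n, Finite {i // h i = n}) (n : ℕ) :
    Finite {x : ι × κ // g x.1 + h x.2 = n} :=
  Finite.of_equiv _ (fiberAddEquiv g h n).symm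

theorem fiberSeries_mul {g : ι → ℕ} {h : κ → ℕ} (hg : ∀ n, Finite {i // g i = n})
    (hh : ∀ n, Finite {i // h i = n}) :
    fiberSeries g * fiberSeries h = fiberSeries (fun x : ι × κ ↦ g x.1 + h x.2) := by
  ext n
  simp only [fiberSeries, coeff_mul, coeff_mk]
  rw [Nat.card_congr (fiberAddEquiv g h n), Nat.card_sigma, Finset.univ_eq_attach,
    Finset.sum_attach (Finset.HasAntidiagonal.antidiagonal n)
      (fun a ↦ Nat.card ({i // g i = a.1} × {j // h j = a.2}))]
  simp [Nat.card_prod]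

theorem natCast_card_eq_card_fixedPoints {α : Type*} [Finite α] {σ : α → α}
    (hσ : Function.Involutive σ) :
    (Nat.card α : ZMod 2) = Nat.card {a // σ a = a} := by
  classical
  have := Fintype.ofFinite α
  have h := Equiv.Perm.card_fixedPoints_modEq (f := (σ : Function.End α)) (p := 2) (n := 1)
    (funext hσ)
  rw [Nat.card_eq_fintype_card, (ZMod.natCast_eq_natCast_iff _ _ _).2 h]
  rw [← Nat.card_eq_fintype_card]
  rfl

theorem fiberSeries_eq_fixedPoints {g : ι → ℕ} (hg : ∀ n, Finite {i // g i = n}) {σ : ι → ι}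
    (hσ : Function.Involutive σ) (hgσ : ∀ i, g (σ i) = g i) :
    fiberSeries g = fiberSeries (fun i : {i // σ i = i} ↦ g i) := by
  ext n
  have := hg n
  let τ : {i // g i = n} → {i // g i = n} := fun i ↦ ⟨σ i, (hgσ i).trans i.2⟩
  have hτ : Function.Involutive τ := fun i ↦ Subtype.ext (hσ i)
  simp only [fiberSeries, coeff_mk]
  rw [natCast_card_eq_card_fixedPoints hτ]
  congr 1
  refine Nat.card_congr ((Equiv.subtypeEquivRight fun i ↦ ?_).trans
    ((Equiv.subtypeSubtypeEquivSubtypeInter (g · = n) fun i ↦ σ i = i).trans <|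
    (Equiv.subtypeEquivRight fun i ↦ and_comm).trans
    (Equiv.subtypeSubtypeEquivSubtypeInter (fun i ↦ σ i = i) (g · = n)).symm))
  simp [τ, Subtype.ext_iff]

theorem finite_fiber_mul {g : ι → ℕ} (hg : ∀ n, Finite {i // g i = n}) {d : ℕ} (hd : d ≠ 0)
    (n : ℕ) : Finite {i // d * g i = n} := by
  have := hg (n / d)
  refine Finite.of_injective (β := {i // g i = n / d}) (fun i ↦ ⟨i.1, ?_⟩) fun x y hxy ↦ ?_
  · exact Nat.eq_div_of_mul_eq_right hd i.2
  · exact Subtype.ext (congrArg (fun z : {i // g i = n / d} ↦ z.1) hxy)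

end FiberSeries

theorem expand_two_eq_sq (f : (ZMod 2)⟦X⟧) : f.expand 2 two_ne_zero = f ^ 2 := by
  have h := MvPowerSeries.map_frobenius_expand (p := 2) (f := f) two_ne_zero
  rwa [ZMod.frobenius_zmod, MvPowerSeries.map_id] at h

theorem expand_four_eq_pow (f : (ZMod 2)⟦X⟧) : f.expand 4 four_ne_zero = f ^ 4 := by
  rw [show f ^ 4 = (f ^ 2) ^ 2 by ring, ← expand_two_eq_sq, ← expand_two_eq_sq]
  exact expand_mul 2 two_ne_zero 2 two_ne_zero f

theorem expand_eight_eq_pow (f : (ZMod 2)⟦X⟧) : f.expand 8 (by norm_num) = f ^ 8 := by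
  rw [show f ^ 8 = (f ^ 4) ^ 2 by ring, ← expand_four_eq_pow, ← expand_two_eq_sq]
  exact expand_mul 2 two_ne_zero 4 four_ne_zero f

theorem pentagonalSeries_eq_fiberSeries :
    pentagonalSeries (ZMod 2) = fiberSeries pentagonal := by
  ext n
  by_cases h : n ∈ Set.range pentagonal
  · obtain ⟨k, rfl⟩ := h
    have : Nat.card {i // pentagonal i = pentagonal k} = 1 := by
      simp [pentagonal_inj]
    rw [coeff_pentagonalSeries_pentagonal, fiberSeries, coeff_mk, this]
    rcases Int.even_or_odd k with hk | hk
    · simp [Int.negOnePow_even k hk]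
    · simp [Int.negOnePow_odd k hk]
  · rw [coeff_pentagonalSeries_eq_zero _ h, coeff_fiberSeries_eq_zero fun i hi ↦ h ⟨i, hi⟩]

theorem finite_fiber_pentagonal (n : ℕ) : Finite {k // pentagonal k = n} :=
  have : Subsingleton {k // pentagonal k = n} :=
    ⟨fun x y ↦ Subtype.ext (pentagonal_injective (x.2.trans y.2.symm))⟩
  inferInstance

/-- Representatives, up to sign, of `0` and of the integers not divisible by `3`. -/
abbrev ThetaIndex : Type := {t : ℤ // t = 0 ∨ t % 3 = 2}

/-- Modulo 2, the power series `1 + ∑ X ^ (m ^ 2)` over positive `m` not divisible by `3`. -/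
noncomputable def thetaSeries : (ZMod 2)⟦X⟧ :=
  fiberSeries fun t : ThetaIndex ↦ t.1.natAbs ^ 2

theorem finite_fiber_theta (n : ℕ) : Finite {t : ThetaIndex // t.1.natAbs ^ 2 = n} := by
  refine Finite.of_injective (β := Set.Icc (-n : ℤ) n) (fun t ↦ ⟨t.1.1, ?_⟩) fun x y hxy ↦ ?_
  · obtain ⟨t, ht⟩ := t
    have : t.1.natAbs ≤ n := by rw [← ht]; exact Nat.le_self_pow two_ne_zero _
    simp only [Set.mem_Icc]
    omega
  · exact Subtype.ext (Subtype.ext (congrArg (fun z : Set.Icc (-n : ℤ) n ↦ z.1) hxy))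

/-- With `u = 3 k + 2 t`, this realises `t ↦ -t` if `t ≡ 0 [ZMOD 3]`, and `u ↦ 1 - u` if
`t ≡ 1 [ZMOD 3]`. -/
def pentagonalSwap (x : ℤ × ℤ) : ℤ × ℤ :=
  if x.2 % 3 = 0 then (x.1 + 4 * (x.2 / 3), -x.2)
  else if x.2 % 3 = 1 then (-1 - 4 * (x.2 / 3) - x.1, x.2)
  else x

theorem pentagonalSwap_involutive : Function.Involutive pentagonalSwap := by
  rintro ⟨k, t⟩
  unfold pentagonalSwap
  grind

theorem pentagonal_add_pentagonalSwap (x : ℤ × ℤ) :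
    pentagonal (pentagonalSwap x).1 +
        2 * pentagonal ((pentagonalSwap x).1 + (pentagonalSwap x).2) =
      pentagonal x.1 + 2 * pentagonal (x.1 + x.2) := by
  obtain ⟨k, t⟩ := x
  zify
  refine mul_left_cancel₀ (two_ne_zero (α := ℤ)) ?_
  simp only [mul_add, two_mul_natCast_pentagonal]
  obtain ⟨s, hs⟩ : ∃ s, s = t / 3 := ⟨_, rfl⟩
  unfold pentagonalSwap
  simp only [← hs]
  split_ifs with h0 h1
  · obtain rfl : t = 3 * s := by omega
    ring
  · obtain rfl : t = 3 * s + 1 := by omega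
    ring
  · rfl

theorem pentagonalSwap_eq_self_iff (x : ℤ × ℤ) :
    pentagonalSwap x = x ↔ x.2 = 0 ∨ x.2 % 3 = 2 := by
  obtain ⟨k, t⟩ := x
  unfold pentagonalSwap
  simp only
  split_ifs with h0 h1
  · simp only [Prod.mk.injEq]; omega
  · simp only [Prod.mk.injEq]; omega
  · simp only [true_iff]; omega

/-- The fixed points of `pentagonalSwap`, with `u = 3 k + 2 t` replaced by the multiple of `3`
among `u` and `1 - u`. -/
def pentagonalSwapFixedEquiv : {x // pentagonalSwap x = x} ≃ ℤ × ThetaIndex where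
  toFun x := (if x.1.2 = 0 then x.1.1 else -1 - 2 * (x.1.2 / 3) - x.1.1,
    ⟨x.1.2, (pentagonalSwap_eq_self_iff x.1).1 x.2⟩)
  invFun y := ⟨(if y.2.1 = 0 then y.1 else -1 - 2 * (y.2.1 / 3) - y.1, y.2.1),
    (pentagonalSwap_eq_self_iff _).2 y.2.2⟩
  left_inv x := by
    obtain ⟨⟨k, t⟩, h⟩ := x
    refine Subtype.ext (Prod.ext ?_ rfl)
    simp only
    split_ifs <;> ring
  right_inv y := by
    obtain ⟨k, t, h⟩ := y
    refine Prod.ext ?_ rfl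
    simp only
    split_ifs <;> ring

theorem pentagonalSeries_pow_three :
    pentagonalSeries (ZMod 2) ^ 3 =
      (pentagonalSeries (ZMod 2)).expand 3 three_ne_zero * thetaSeries := by
  have hfin := finite_fiber_pentagonal
  have hshift : fiberSeries (fun x : ℤ × ℤ ↦ pentagonal x.1 + 2 * pentagonal x.2) =
      fiberSeries (fun x : ℤ × ℤ ↦ pentagonal x.1 + 2 * pentagonal (x.1 + x.2)) :=
    (fiberSeries_congr (Equiv.prodShear (Equiv.refl ℤ) Equiv.addLeft) fun x ↦ rfl).symm
  have hfin' (n : ℕ) :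
      Finite {x : ℤ × ℤ // pentagonal x.1 + 2 * pentagonal (x.1 + x.2) = n} := by
    have := finite_fiber_add hfin (finite_fiber_mul hfin two_ne_zero) n
    exact Finite.of_equiv _ ((Equiv.prodShear (Equiv.refl ℤ) Equiv.addLeft).subtypeEquiv
      (p := fun x : ℤ × ℤ ↦ pentagonal x.1 + 2 * pentagonal (x.1 + x.2) = n)
      (q := fun x : ℤ × ℤ ↦ pentagonal x.1 + 2 * pentagonal x.2 = n) fun x ↦ Iff.rfl).symm
  rw [pow_succ', ← expand_two_eq_sq, pentagonalSeries_eq_fiberSeries, expand_fiberSeries,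
    expand_fiberSeries, thetaSeries, fiberSeries_mul hfin (finite_fiber_mul hfin two_ne_zero),
    fiberSeries_mul (finite_fiber_mul hfin three_ne_zero) finite_fiber_theta, hshift,
    fiberSeries_eq_fixedPoints hfin' pentagonalSwap_involutive pentagonal_add_pentagonalSwap]
  refine fiberSeries_congr pentagonalSwapFixedEquiv ?_
  rintro ⟨⟨k, t⟩, h⟩
  rw [pentagonalSwap_eq_self_iff] at h
  simp only at h
  simp only [pentagonalSwapFixedEquiv, Equiv.coe_fn_mk]
  zify
  refine mul_left_cancel₀ (two_ne_zero (α := ℤ)) ?_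
  simp only [mul_add, mul_left_comm (2 : ℤ) _ (pentagonal _ : ℤ), two_mul_natCast_pentagonal,
    sq_abs]
  split_ifs with h0
  · subst h0
    ring
  · obtain ⟨s, hs⟩ : ∃ s, s = t / 3 := ⟨_, rfl⟩
    rw [← hs]
    obtain rfl : t = 3 * s + 2 := by omega
    ring

/-- Modulo 2, the generating function of `PD k`. -/
noncomputable def designatedSeries (k : ℕ) : (ZMod 2)⟦X⟧ :=
  genFun fun i c ↦ if k ∣ i then 0 else (c : ZMod 2)

theorem coeff_designatedSeries (k n : ℕ) : (designatedSeries k).coeff n = (PD k n : ZMod 2) := by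
  simp only [designatedSeries, coeff_genFun, PD, Nat.cast_sum]
  refine Finset.sum_congr rfl fun p _ ↦ ?_
  simp only [Finsupp.prod, Multiset.toFinsupp_support, Multiset.toFinsupp_apply]
  split_ifs with h
  · rw [Nat.cast_prod]
    exact Finset.prod_congr rfl fun s hs ↦ if_neg (h s (Multiset.mem_toFinset.1 hs))
  · push Not at h
    obtain ⟨s, hs, hks⟩ := h
    rw [Nat.cast_zero]
    exact Finset.prod_eq_zero (Multiset.mem_toFinset.2 hs) (if_pos hks)

/-- Modulo 2, the contribution `1 + ∑ c X ^ c` of the part size `1` to the generating function. -/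
noncomputable def designatedFactor : (ZMod 2)⟦X⟧ :=
  1 + X * .mk fun n ↦ (n + 1 : ZMod 2)

theorem designatedFactor_mul_one_sub_X_pow_three :
    designatedFactor * (1 - X) ^ 3 = 1 - X ^ 3 := by
  have h1 : (mk 1 : (ZMod 2)⟦X⟧) * (1 - X) = 1 := mk_one_mul_one_sub_eq_one _
  have h2 : (.mk fun n ↦ (n + 1 : ZMod 2)) = (mk 1 : (ZMod 2)⟦X⟧) ^ 2 := by
    rw [mk_one_pow_eq_mk_choose_add (ZMod 2) 1]
    ext n
    simp [add_comm]
  have h3 : (2 : (ZMod 2)⟦X⟧) = 0 := by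
    rw [← map_ofNat C 2, show (OfNat.ofNat 2 : ZMod 2) = 0 from rfl, map_zero]
  rw [designatedFactor, h2]
  linear_combination (X * (1 - X) * ((mk 1 : (ZMod 2)⟦X⟧) * (1 - X) + 1)) * h1 -
    (X * (1 - X)) * h3

section Products

variable [TopologicalSpace (ZMod 2)]

theorem continuous_expand (d : ℕ) (hd : d ≠ 0) :
    Continuous (expand d hd : (ZMod 2)⟦X⟧ →ₐ[ZMod 2] (ZMod 2)⟦X⟧) := by
  rw [continuous_iff_continuousAt]
  intro f
  rw [ContinuousAt, tendsto_iff_coeff_tendsto]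
  intro n
  simp only [coeff_expand]
  split_ifs
  · exact (continuous_coeff _ _).tendsto f
  · exact tendsto_const_nhds

theorem hasProd_designatedSeries [T2Space (ZMod 2)] [IsTopologicalSemiring (ZMod 2)] (k : ℕ) :
    HasProd (fun i ↦ if k ∣ i + 1 then 1 else designatedFactor.expand (i + 1) i.succ_ne_zero)
      (designatedSeries k) := by
  convert! hasProd_genFun (fun i c ↦ if k ∣ i then 0 else (c : ZMod 2)) using 1
  ext1 i
  split_ifs with h
  · simp
  have h1 : HasSum (fun j : ℕ ↦ ((j + 1 : ℕ) : ZMod 2) • (X : (ZMod 2)⟦X⟧) ^ ((i + 1) * j))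
      ((PowerSeries.mk fun n ↦ (n + 1 : ZMod 2)).expand (i + 1) i.succ_ne_zero) := by
    convert! (hasSum_of_monomials_self (PowerSeries.mk fun n ↦ (n + 1 : ZMod 2))).map
      (expand (i + 1) i.succ_ne_zero) (continuous_expand _ _) using 1
    ext1 j
    simp [monomial_eq_C_mul_X_pow, smul_eq_C_mul, pow_mul]
  have h2 := (h1.mul_left (X ^ (i + 1))).tsum_eq
  rw [designatedFactor, map_add, map_mul, map_one, expand_X, ← h2]
  congr 1
  refine tsum_congr fun j ↦ ?_
  rw [mul_smul_comm, ← pow_add, mul_add_one, add_comm (i + 1)]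

theorem designatedSeries_zero_mul_pow_three [T2Space (ZMod 2)] [IsTopologicalRing (ZMod 2)] :
    designatedSeries 0 * pentagonalSeries (ZMod 2) ^ 3 =
      (pentagonalSeries (ZMod 2)).expand 3 three_ne_zero := by
  have hP := hasProd_one_sub_X_pow (ZMod 2)
  have hD := hasProd_designatedSeries 0
  have hE := hP.map (expand 3 three_ne_zero) (continuous_expand _ _)
  have hPP := (hP.mul hP).mul hP
  rw [pow_succ, sq]
  refine (hD.mul hPP).unique ?_
  convert! hE using 1
  ext1 i
  have h := congrArg (expand (i + 1) i.succ_ne_zero) designatedFactor_mul_one_sub_X_pow_three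
  simp only [map_mul, map_sub, map_pow, map_one, expand_X] at h
  simp only [zero_dvd_iff, Nat.succ_ne_zero, if_false, Function.comp_apply, map_sub, map_pow,
    map_one, expand_X]
  rw [← sq, ← pow_succ, h, pow_right_comm]

theorem designatedSeries_mul_expand [T2Space (ZMod 2)] [IsTopologicalRing (ZMod 2)]
    (k : ℕ) (hk : k ≠ 0) :
    designatedSeries k * (designatedSeries 0).expand k hk = designatedSeries 0 := by
  have h0 := hasProd_designatedSeries 0
  have hE := h0.map (expand k hk) (continuous_expand _ _)
  let e : ℕ → ℕ := fun i ↦ k * (i + 1) - 1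
  have he (i : ℕ) : e i + 1 = k * (i + 1) :=
    Nat.sub_add_cancel (Nat.one_le_iff_ne_zero.2 (mul_ne_zero hk i.succ_ne_zero))
  have hinj : Function.Injective e := fun i j hij ↦ by
    have := congrArg (· + 1) hij
    simpa [he, hk] using this
  have hE' : HasProd
      (fun i ↦ if k ∣ i + 1 then designatedFactor.expand (i + 1) i.succ_ne_zero else 1)
      ((designatedSeries 0).expand k hk) := by
    rw [← hinj.hasProd_iff]
    · convert! hE using 1
      ext1 i
      simp only [Function.comp_apply, he, dvd_mul_right, if_true, zero_dvd_iff, Nat.succ_ne_zero,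
        if_false]
      exact expand_mul k hk (i + 1) i.succ_ne_zero _
    · intro i hi
      refine if_neg fun ⟨j, hj⟩ ↦ hi ⟨j - 1, ?_⟩
      have hj0 : j ≠ 0 := by rintro rfl; simp at hj
      simp only [e]
      rw [Nat.sub_add_cancel (Nat.one_le_iff_ne_zero.2 hj0), ← hj, Nat.add_sub_cancel]
  refine ((hasProd_designatedSeries k).mul hE').unique ?_
  convert! h0 using 1
  ext1 i
  simp only [zero_dvd_iff, Nat.succ_ne_zero, if_false]
  split_ifs <;> simp

end Products

theorem designatedSeries_zero_mul_thetaSeries : designatedSeries 0 * thetaSeries = 1 := by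
  let : TopologicalSpace (ZMod 2) := ⊥
  have : DiscreteTopology (ZMod 2) := ⟨rfl⟩
  have hP : pentagonalSeries (ZMod 2) ≠ 0 := by
    rw [← tprod_one_sub_X_pow]
    exact tprod_one_sub_X_pow_ne_zero (ZMod 2)
  have h := designatedSeries_zero_mul_pow_three
  have hE : (pentagonalSeries (ZMod 2)).expand 3 three_ne_zero ≠ 0 := by
    intro h0
    exact pow_ne_zero 3 hP (by rw [pentagonalSeries_pow_three, h0, zero_mul])
  rw [pentagonalSeries_pow_three] at h
  exact mul_left_cancel₀ hE (by linear_combination h)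

theorem designatedSeries_eq_thetaSeries_pow (k : ℕ)
    (hk : ∀ f : (ZMod 2)⟦X⟧, f.expand (k + 1) k.succ_ne_zero = f ^ (k + 1)) :
    designatedSeries (k + 1) = thetaSeries ^ k := by
  let : TopologicalSpace (ZMod 2) := ⊥
  have : DiscreteTopology (ZMod 2) := ⟨rfl⟩
  have h := designatedSeries_mul_expand (k + 1) k.succ_ne_zero
  have h1 := designatedSeries_zero_mul_thetaSeries
  rw [hk] at h
  calc designatedSeries (k + 1) =
        designatedSeries (k + 1) * (designatedSeries 0 * thetaSeries) ^ (k + 1) := by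
        rw [h1, one_pow, mul_one]
    _ = designatedSeries (k + 1) * designatedSeries 0 ^ (k + 1) * thetaSeries ^ (k + 1) := by ring
    _ = designatedSeries 0 * thetaSeries * thetaSeries ^ k := by rw [h]; ring
    _ = thetaSeries ^ k := by rw [h1, one_mul]

theorem designatedSeries_four_eq_fiberSeries :
    designatedSeries 4 = fiberSeries fun x : ThetaIndex × ThetaIndex ↦
      x.1.1.natAbs ^ 2 + 2 * x.2.1.natAbs ^ 2 := by
  rw [designatedSeries_eq_thetaSeries_pow 3 expand_four_eq_pow, pow_succ', ← expand_two_eq_sq,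
    thetaSeries, expand_fiberSeries,
    fiberSeries_mul finite_fiber_theta (finite_fiber_mul finite_fiber_theta two_ne_zero)]

theorem finite_fiber_theta_pow_seven (n : ℕ) :
    Finite {x : ThetaIndex × ThetaIndex × ThetaIndex //
      x.1.1.natAbs ^ 2 + (2 * x.2.1.1.natAbs ^ 2 + 4 * x.2.2.1.natAbs ^ 2) = n} :=
  finite_fiber_add finite_fiber_theta (finite_fiber_add
    (finite_fiber_mul finite_fiber_theta two_ne_zero)
    (finite_fiber_mul finite_fiber_theta four_ne_zero)) n

theorem designatedSeries_eight_eq_fiberSeries :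
    designatedSeries 8 = fiberSeries fun x : ThetaIndex × ThetaIndex × ThetaIndex ↦
      x.1.1.natAbs ^ 2 + (2 * x.2.1.1.natAbs ^ 2 + 4 * x.2.2.1.natAbs ^ 2) := by
  have h2 := finite_fiber_mul finite_fiber_theta two_ne_zero
  have h4 := finite_fiber_mul finite_fiber_theta four_ne_zero
  rw [designatedSeries_eq_thetaSeries_pow 7 expand_eight_eq_pow,
    show thetaSeries ^ 7 = thetaSeries * (thetaSeries ^ 2 * thetaSeries ^ 4) by ring,
    ← expand_two_eq_sq, ← expand_four_eq_pow, thetaSeries, expand_fiberSeries, expand_fiberSeries,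
    fiberSeries_mul h2 h4, fiberSeries_mul finite_fiber_theta (finite_fiber_add h2 h4)]

/-- The exchange of `s / 2` and `u` in a solution of `s ^ 2 + 2 t ^ 2 + 4 u ^ 2 = n`, up to signs. -/
def thetaSwap (x : ThetaIndex × ThetaIndex × ThetaIndex) : ThetaIndex × ThetaIndex × ThetaIndex :=
  if h : x.1.1 % 2 = 0 then
    (⟨-2 * x.2.2.1, by have := x.2.2.2; omega⟩, x.2.1, ⟨-(x.1.1 / 2), by have := x.1.2; omega⟩)
  else x

theorem thetaSwap_involutive : Function.Involutive thetaSwap := by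
  rintro ⟨⟨s, hs⟩, ⟨t, ht⟩, ⟨u, hu⟩⟩
  by_cases h : s % 2 = 0
  · have h' : (-2 * u) % 2 = 0 := by omega
    simp only [thetaSwap, h, h', dif_pos, Prod.mk.injEq, Subtype.mk.injEq, true_and]
    omega
  · simp [thetaSwap, h]

theorem sq_add_thetaSwap (x : ThetaIndex × ThetaIndex × ThetaIndex) :
    (thetaSwap x).1.1.natAbs ^ 2 +
        (2 * (thetaSwap x).2.1.1.natAbs ^ 2 + 4 * (thetaSwap x).2.2.1.natAbs ^ 2) =
      x.1.1.natAbs ^ 2 + (2 * x.2.1.1.natAbs ^ 2 + 4 * x.2.2.1.natAbs ^ 2) := by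
  obtain ⟨⟨s, hs⟩, ⟨t, ht⟩, ⟨u, hu⟩⟩ := x
  by_cases h : s % 2 = 0
  · obtain ⟨v, rfl⟩ : ∃ v, s = 2 * v := ⟨s / 2, by omega⟩
    zify
    simp only [thetaSwap, h, dif_pos, sq_abs]
    rw [Int.mul_ediv_cancel_left v two_ne_zero]
    ring
  · simp [thetaSwap, h]

theorem sq_mod_thirty_two_mem (a : ℕ) :
    a ^ 2 % 32 ∈ ({0, 1, 4, 9, 16, 17, 25} : Finset ℕ) := by
  have h : ∀ b < 32, b ^ 2 % 32 ∈ ({0, 1, 4, 9, 16, 17, 25} : Finset ℕ) := by decide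
  rw [Nat.pow_mod]
  exact h _ (Nat.mod_lt _ (by norm_num))

theorem sq_add_two_mul_sq_ne {r : ℕ}
    (hr : r ∈ ({5, 7, 10, 13, 14, 15, 20, 21, 23, 26, 28, 29, 30, 31} : Finset ℕ)) (n a b : ℕ) :
    a ^ 2 + 2 * b ^ 2 ≠ 32 * n + r := by
  have h : ∀ x ∈ ({0, 1, 4, 9, 16, 17, 25} : Finset ℕ),
      ∀ y ∈ ({0, 1, 4, 9, 16, 17, 25} : Finset ℕ),
      (x + 2 * y) % 32 ∉
        ({5, 7, 10, 13, 14, 15, 20, 21, 23, 26, 28, 29, 30, 31} : Finset ℕ) := by decide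
  have hlt : ∀ r ∈ ({5, 7, 10, 13, 14, 15, 20, 21, 23, 26, 28, 29, 30, 31} : Finset ℕ),
      r < 32 := by decide
  intro heq
  have := hlt r hr
  refine h _ (sq_mod_thirty_two_mem a) _ (sq_mod_thirty_two_mem b) ?_
  rwa [show (a ^ 2 % 32 + 2 * (b ^ 2 % 32)) % 32 = r by omega]

theorem eight_mul_sq_add_two_mul_sq_ne (n a b : ℕ) : 8 * a ^ 2 + 2 * b ^ 2 ≠ 32 * n + 24 := by
  have h : ∀ x ∈ ({0, 1, 4, 9, 16, 17, 25} : Finset ℕ),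
      ∀ y ∈ ({0, 1, 4, 9, 16, 17, 25} : Finset ℕ), (8 * x + 2 * y) % 32 ≠ 24 := by decide
  intro heq
  refine h _ (sq_mod_thirty_two_mem a) _ (sq_mod_thirty_two_mem b) ?_
  omega

theorem PD_mod_two_eq_zero_iff (k n : ℕ) : PD k n % 2 = 0 ↔ (designatedSeries k).coeff n = 0 := by
  rw [coeff_designatedSeries, ZMod.natCast_eq_zero_iff, Nat.dvd_iff_mod_eq_zero]

theorem coeff_designatedSeries_eight (n : ℕ) : (designatedSeries 8).coeff (32 * n + 24) = 0 := by
  rw [designatedSeries_eight_eq_fiberSeries, fiberSeries_eq_fixedPoints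
    finite_fiber_theta_pow_seven thetaSwap_involutive sq_add_thetaSwap]
  refine coeff_fiberSeries_eq_zero ?_
  rintro ⟨⟨⟨s, hs⟩, ⟨t, ht⟩, ⟨u, hu⟩⟩, h⟩ heq
  simp only at heq
  by_cases h2 : s % 2 = 0
  · simp only [thetaSwap, h2, dif_pos, Prod.mk.injEq, Subtype.mk.injEq, true_and] at h
    have hs' : s.natAbs = 2 * u.natAbs := by omega
    rw [hs'] at heq
    exact eight_mul_sq_add_two_mul_sq_ne n u.natAbs t.natAbs (by linarith)
  · have hodd : s.natAbs ^ 2 % 2 = 1 := by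
      rw [Nat.pow_mod, show s.natAbs % 2 = 1 by omega]
    omega

end DesignatedSummands

theorem stmt_1 :
    (∀ n : ℕ, ∀ r ∈ ({5, 7, 10, 13, 14, 15, 20, 21, 23, 26, 28, 29, 30, 31} : Finset ℕ),
      PD 4 (32 * n + r) % 2 = 0) ∧
    (∀ n : ℕ, PD 8 (32 * n + 24) % 2 = 0) := by
  refine ⟨fun n r hr ↦ ?_, fun n ↦ ?_⟩
  · rw [DesignatedSummands.PD_mod_two_eq_zero_iff,
      DesignatedSummands.designatedSeries_four_eq_fiberSeries]
    exact DesignatedSummands.coeff_fiberSeries_eq_zero fun x ↦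
      DesignatedSummands.sq_add_two_mul_sq_ne hr n _ _
  · rw [DesignatedSummands.PD_mod_two_eq_zero_iff]
    exact DesignatedSummands.coeff_designatedSeries_eight n
end

section
/- Let ℓ ≥ 3 and let s be an integer with 0 ≤ s < 2^{ℓ-1} such that there is no integer x with x² ≡ s (mod 2^{ℓ-1}) (i.e., s is a quadratic nonresidue modulo 2^{ℓ-1}). Then for all integers n ≥ 0, PD_{2^ℓ}(2^ℓ n + 2s) ≡ 0 (mod 2). -/
open Finset PowerSeries WithPiTopology

/-- Representations of `M` as `x ^ 2 + 2 * y ^ 2` with `x` and `y` coprime to `3`. -/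
def primitiveReps (M : ℕ) : Finset (ℕ × ℕ) :=
  (range (M + 1) ×ˢ range (M + 1)).filter fun p =>
    ¬ 3 ∣ p.1 ∧ ¬ 3 ∣ p.2 ∧ p.1 ^ 2 + 2 * p.2 ^ 2 = M

/-- Representations of `M` as `x ^ 2 + 8 * y ^ 2` with `3 ∤ x`, and `y = 0` or `3 ∤ y`. -/
def evenReps (M : ℕ) : Finset (ℕ × ℕ) :=
  (range (M + 1) ×ˢ range (M + 1)).filter fun p =>
    ¬ 3 ∣ p.1 ∧ (p.2 = 0 ∨ ¬ 3 ∣ p.2) ∧ p.1 ^ 2 + 8 * p.2 ^ 2 = M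

/-- Integer representations of `M` as `u ^ 2 + 2 * w ^ 2` with `0 < u` and `3 ∤ u + w`. -/
noncomputable def signedReps (M : ℕ) : Finset (ℤ × ℤ) :=
  (Icc 1 (M : ℤ) ×ˢ Icc (-M : ℤ) M).filter fun p =>
    ¬ 3 ∣ p.1 + p.2 ∧ p.1 ^ 2 + 2 * p.2 ^ 2 = M

lemma mem_primitiveReps {M : ℕ} {p : ℕ × ℕ} : p ∈ primitiveReps M ↔
    ¬ 3 ∣ p.1 ∧ ¬ 3 ∣ p.2 ∧ p.1 ^ 2 + 2 * p.2 ^ 2 = M := by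
  simp only [primitiveReps, mem_filter, mem_product, mem_range, and_iff_right_iff_imp]
  rintro ⟨-, -, h⟩
  constructor <;> nlinarith [Nat.le_self_pow two_ne_zero p.1, Nat.le_self_pow two_ne_zero p.2]

lemma mem_evenReps {M : ℕ} {p : ℕ × ℕ} : p ∈ evenReps M ↔
    ¬ 3 ∣ p.1 ∧ (p.2 = 0 ∨ ¬ 3 ∣ p.2) ∧ p.1 ^ 2 + 8 * p.2 ^ 2 = M := by
  simp only [evenReps, mem_filter, mem_product, mem_range, and_iff_right_iff_imp]
  rintro ⟨-, -, h⟩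
  constructor <;> nlinarith [Nat.le_self_pow two_ne_zero p.1, Nat.le_self_pow two_ne_zero p.2]

lemma mem_signedReps {M : ℕ} {p : ℤ × ℤ} : p ∈ signedReps M ↔
    0 < p.1 ∧ ¬ 3 ∣ p.1 + p.2 ∧ p.1 ^ 2 + 2 * p.2 ^ 2 = M := by
  simp only [signedReps, mem_filter, mem_product, mem_Icc]
  constructor
  · rintro ⟨⟨⟨h, -⟩, -⟩, h₁, h₂⟩
    exact ⟨by omega, h₁, h₂⟩
  · rintro ⟨h, h₁, h₂⟩
    refine ⟨⟨⟨by omega, ?_⟩, ?_, ?_⟩, h₁, h₂⟩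
    · nlinarith [Int.le_self_sq p.1, sq_nonneg p.2]
    · nlinarith [Int.le_self_sq (-p.2), sq_nonneg p.1]
    · nlinarith [Int.le_self_sq p.2, sq_nonneg p.1]

lemma card_signedReps {M : ℕ} (hM : M % 2 = 1) :
    (signedReps M).card = (primitiveReps (3 * M)).card := by
  refine card_bij (fun p _ => ((p.1 - 2 * p.2).natAbs, (p.1 + p.2).natAbs)) ?_ ?_ ?_
  · rintro ⟨u, w⟩ h
    rw [mem_signedReps] at h
    rw [mem_primitiveReps]
    dsimp only at h ⊢
    refine ⟨by omega, by omega, ?_⟩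
    zify
    rw [sq_abs, sq_abs]
    linear_combination 3 * h.2.2
  · rintro ⟨u, w⟩ h ⟨u', w'⟩ h' heq
    rw [mem_signedReps] at h h'
    simp only [Prod.mk.injEq] at h h' heq ⊢
    omega
  · rintro ⟨x, y⟩ h
    rw [mem_primitiveReps] at h
    dsimp only at h
    obtain ⟨hx, hy, h⟩ := h
    have hodd : x % 2 = 1 := by
      by_contra hx'
      obtain ⟨z, rfl⟩ : 2 ∣ x := by omega
      ring_nf at h
      omega
    have hz : (x : ℤ) ^ 2 + 2 * (y : ℤ) ^ 2 = 3 * M := by exact_mod_cast h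
    obtain ⟨u, w, hu, huw, hx', hy'⟩ : ∃ u w : ℤ, 0 < u ∧ ¬ 3 ∣ u + w ∧
        (u - 2 * w).natAbs = x ∧ (u + w).natAbs = y := by
      by_cases hc : (x : ℤ) % 3 = y % 3
      · exact ⟨(x + 2 * y) / 3, (y - x) / 3, by omega, by omega, by omega, by omega⟩
      · have hsum : ((x : ℤ) + y) % 3 = 0 := by omega
        rcases lt_or_ge (0 : ℤ) (x - 2 * y) with hlt | hle
        · exact ⟨(x - 2 * y) / 3, (-y - x) / 3, by omega, by omega, by omega, by omega⟩
        · exact ⟨(2 * y - x) / 3, (x + y) / 3, by omega, by omega, by omega, by omega⟩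
    refine ⟨(u, w), mem_signedReps.2 ⟨hu, huw, ?_⟩, by simp [hx', hy']⟩
    rw [← hx', ← hy'] at hz
    simp only [Int.natCast_natAbs, sq_abs] at hz
    dsimp only
    linarith

lemma even_of_sq_add_two_mul_sq {u w : ℤ} (h : (u ^ 2 + 2 * w ^ 2) % 8 = 1) : w % 2 = 0 := by
  have hu : u % 8 = 0 ∨ u % 8 = 1 ∨ u % 8 = 2 ∨ u % 8 = 3 ∨ u % 8 = 4 ∨ u % 8 = 5 ∨
    u % 8 = 6 ∨ u % 8 = 7 := by omega
  rcases Int.emod_two_eq_zero_or_one w with hw | hw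
  · exact hw
  · obtain ⟨v, rfl⟩ : ∃ v, w = 2 * v + 1 := ⟨w / 2, by omega⟩
    have h1 : (u ^ 2 + 2 * (2 * v + 1) ^ 2) % 8 = (u ^ 2 + 2) % 8 := by
      obtain ⟨t, ht⟩ := Int.even_mul_succ_self v
      rw [show u ^ 2 + 2 * (2 * v + 1) ^ 2 = u ^ 2 + 2 + 8 * (v * (v + 1)) by ring]
      omega
    rw [h1, Int.add_emod, pow_two, Int.mul_emod] at h
    rcases hu with hu | hu | hu | hu | hu | hu | hu | hu <;> rw [hu] at h <;> omega

lemma card_evenReps {M : ℕ} (hM : M % 8 = 1) :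
    ((signedReps M).filter fun p => ¬ (p.2 ≠ 0 ∧ ¬ 3 ∣ p.1 - p.2)).card = (evenReps M).card := by
  have heven : ∀ u w : ℤ, u ^ 2 + 2 * w ^ 2 = M → w % 2 = 0 := fun u w h =>
    even_of_sq_add_two_mul_sq (u := u) (by omega)
  refine card_bij (fun p _ => (p.1.natAbs, p.2.natAbs / 2)) ?_ ?_ ?_
  · rintro ⟨u, w⟩ h
    simp only [mem_filter, mem_signedReps] at h
    obtain ⟨⟨hu, huw, h⟩, hw⟩ := h
    obtain ⟨m, rfl⟩ : 2 ∣ w := Int.dvd_of_emod_eq_zero (heven u w h)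
    have hm : (2 * m).natAbs / 2 = m.natAbs := by omega
    rw [mem_evenReps]
    dsimp only
    rw [hm]
    refine ⟨by omega, by omega, ?_⟩
    zify
    rw [sq_abs, sq_abs]
    linear_combination h
  · rintro ⟨u, w⟩ h ⟨u', w'⟩ h' heq
    simp only [mem_filter, mem_signedReps, Prod.mk.injEq] at h h' heq ⊢
    have := heven u w h.1.2.2
    have := heven u' w' h'.1.2.2
    omega
  · rintro ⟨x, m⟩ h
    rw [mem_evenReps] at h
    dsimp only at h
    obtain ⟨hx, hm, h⟩ := h
    have hz : (x : ℤ) ^ 2 + 8 * (m : ℤ) ^ 2 = M := by exact_mod_cast h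
    have hx3 : x % 3 = 1 ∨ x % 3 = 2 := by omega
    have hm3 : m = 0 ∨ m % 3 = 1 ∨ m % 3 = 2 := by omega
    obtain ⟨w, hw, hxw, hw'⟩ : ∃ w : ℤ, w.natAbs = 2 * m ∧ ¬ 3 ∣ x + w ∧
        ¬ (w ≠ 0 ∧ ¬ 3 ∣ x - w) := by
      by_cases hc : (3 : ℤ) ∣ x - 2 * m
      · exact ⟨2 * m, by omega, by omega, by omega⟩
      · have : m = 0 ∨ ((x : ℤ) + 2 * m) % 3 = 0 := by
          rcases hx3 with _ | _ <;> rcases hm3 with _ | _ | _ <;> omega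
        exact ⟨-(2 * m), by omega, by omega, by omega⟩
    refine ⟨(x, w), ?_, by simp [hw]⟩
    simp only [mem_filter, mem_signedReps]
    refine ⟨⟨by omega, hxw, ?_⟩, hw'⟩
    rw [← Int.natAbs_sq w, hw]
    push_cast
    linear_combination hz

lemma card_primitiveReps_eq {M : ℕ} (hM : M % 8 = 1) :
    ((primitiveReps (3 * M)).card : ZMod 2) = (evenReps M).card := by
  rw [← card_signedReps (by omega), ← card_evenReps hM,
    ← card_filter_add_card_filter_not (s := signedReps M) fun p => p.2 ≠ 0 ∧ ¬ 3 ∣ p.1 - p.2,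
    Nat.cast_add, add_eq_right, card_eq_sum_ones, Nat.cast_sum]
  refine sum_involution (fun p _ => (p.1, -p.2)) ?_ ?_ ?_ ?_
  · intros; decide
  · rintro ⟨u, w⟩ h - heq
    simp only [mem_filter, Prod.mk.injEq] at h heq
    omega
  · rintro ⟨u, w⟩ h
    simp only [mem_filter, mem_signedReps] at h ⊢
    exact ⟨⟨h.1.1, by omega, by linarith [h.1.2.2, neg_sq w]⟩, by omega, by omega⟩
  · simp

lemma odd_of_sq_mod_two {x : ℕ} (h : x ^ 2 % 2 = 1) : x % 2 = 1 := by
  rcases Nat.mod_two_eq_zero_or_one x with hx | hx <;> simp_all [Nat.pow_mod]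

lemma odd_of_sq_add_two_mul_sq {x y n : ℕ} (h : x ^ 2 + 2 * y ^ 2 = 3 * (8 * n + 1)) :
    x % 2 = 1 ∧ y % 2 = 1 := by
  have hx := odd_of_sq_mod_two (x := x) (by omega)
  refine ⟨hx, ?_⟩
  obtain ⟨z, rfl⟩ : ∃ z, x = 2 * z + 1 := ⟨x / 2, by omega⟩
  obtain ⟨t, ht⟩ := Nat.even_mul_succ_self z
  rw [show (2 * z + 1) ^ 2 = 4 * (z * (z + 1)) + 1 by ring] at h
  exact odd_of_sq_mod_two (by omega)

lemma sq_mod_of_coprime_six {x : ℕ} (h2 : x % 2 = 1) (h3 : ¬ 3 ∣ x) : x ^ 2 % 24 = 1 := by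
  have : x % 24 < 24 := Nat.mod_lt _ (by norm_num)
  rw [Nat.pow_mod]
  have h2' : x % 24 % 2 = 1 := by omega
  have h3' : x % 24 % 3 ≠ 0 := by omega
  generalize x % 24 = r at *
  interval_cases r <;> omega

/-- The series `1 + ∑ X ^ (m ^ 2)` over the positive integers `m` coprime to `3`. -/
noncomputable def squareSeries : PowerSeries (ZMod 2) :=
  .mk fun n => open Classical in if ∃ m, m ^ 2 = n ∧ (m = 0 ∨ ¬ 3 ∣ m) then 1 else 0

lemma mem_range_pentagonal_iff {n : ℕ} :
    n ∈ Set.range pentagonal ↔ ∃ x, ¬ 3 ∣ x ∧ x ^ 2 = 24 * n + 1 := by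
  constructor
  · rintro ⟨k, rfl⟩
    refine ⟨(6 * k - 1).natAbs, by omega, ?_⟩
    zify
    rw [sq_abs]
    linear_combination -12 * two_mul_natCast_pentagonal k
  · rintro ⟨x, hx, h⟩
    have hodd : x % 2 = 1 := by
      by_contra hx'
      obtain ⟨z, rfl⟩ : 2 ∣ x := by omega
      ring_nf at h
      omega
    obtain ⟨k, hk⟩ : ∃ k : ℤ, x = 6 * k - 1 ∨ x = -(6 * k - 1) := by
      have hx6 : x % 6 = 5 ∨ x % 6 = 1 := by omega
      rcases hx6 with hx6 | hx6
      · exact ⟨(x + 1) / 6, by omega⟩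
      · exact ⟨-((x - 1) / 6), by omega⟩
    have hk' : ((6 * k - 1) ^ 2 : ℤ) = 24 * n + 1 := by
      rw [← sq_eq_sq_iff_eq_or_eq_neg] at hk
      rw [← hk]
      exact_mod_cast h
    refine ⟨k, ?_⟩
    have := two_mul_natCast_pentagonal k
    zify
    linarith

lemma coeff_pentagonalSeries_zmod_two (n : ℕ) : (pentagonalSeries (ZMod 2)).coeff n =
    open Classical in if ∃ x, ¬ 3 ∣ x ∧ x ^ 2 = 24 * n + 1 then 1 else 0 := by
  rw [← mem_range_pentagonal_iff]
  split_ifs with h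
  · obtain ⟨k, rfl⟩ := h
    have : ∀ z : ZMod 2, z ≠ 0 → z = 1 := by decide
    apply this
    rw [Ne, coeff_pentagonalSeries_eq_zero_iff]
    simp
  · exact coeff_pentagonalSeries_eq_zero _ h

lemma coeff_mul_indicator {R : Type*} [Semiring R] {f g : PowerSeries R} {p q : ℕ → Prop}
    [DecidablePred p] [DecidablePred q] (hf : ∀ n, f.coeff n = if p n then 1 else 0)
    (hg : ∀ n, g.coeff n = if q n then 1 else 0) (n : ℕ) :
    (f * g).coeff n = ((antidiagonal n).filter fun a => p a.1 ∧ q a.2).card := by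
  rw [coeff_mul, card_filter, Nat.cast_sum]
  refine sum_congr rfl fun a _ => ?_
  rw [hf, hg]
  by_cases hp : p a.1 <;> by_cases hq : q a.2 <;> simp [hp, hq]

lemma pentagonalSeries_mul_expand_two :
    pentagonalSeries (ZMod 2) * expand 2 two_ne_zero (pentagonalSeries (ZMod 2)) =
      expand 3 three_ne_zero (pentagonalSeries (ZMod 2)) * squareSeries := by
  classical
  have hexp (k : ℕ) (hk : k ≠ 0) (n : ℕ) : (expand k hk (pentagonalSeries (ZMod 2))).coeff n =
      if k ∣ n ∧ ∃ x, ¬ 3 ∣ x ∧ x ^ 2 = 24 * (n / k) + 1 then 1 else 0 := by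
    rw [coeff_expand, coeff_pentagonalSeries_zmod_two, ite_and]
  ext n
  rw [coeff_mul_indicator coeff_pentagonalSeries_zmod_two (hexp 2 two_ne_zero),
    coeff_mul_indicator (g := squareSeries) (hexp 3 three_ne_zero) fun n => coeff_mk _ _]
  have h1 : (primitiveReps (3 * (8 * n + 1))).card = ((antidiagonal n).filter fun a =>
      (∃ x, ¬ 3 ∣ x ∧ x ^ 2 = 24 * a.1 + 1) ∧
        2 ∣ a.2 ∧ ∃ x, ¬ 3 ∣ x ∧ x ^ 2 = 24 * (a.2 / 2) + 1).card := by
    refine card_bij (fun p _ => (p.1 ^ 2 / 24, 2 * (p.2 ^ 2 / 24))) ?_ ?_ ?_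
    · rintro ⟨x, y⟩ h
      rw [mem_primitiveReps] at h
      obtain ⟨hx, hy, h⟩ := h
      dsimp only at hx hy h
      obtain ⟨hx', hy'⟩ := odd_of_sq_add_two_mul_sq h
      have := sq_mod_of_coprime_six hx' hx
      have := sq_mod_of_coprime_six hy' hy
      simp only [mem_filter, HasAntidiagonal.mem_antidiagonal]
      refine ⟨by omega, ⟨x, hx, by omega⟩, by omega, y, hy, by omega⟩
    · rintro ⟨x, y⟩ h ⟨x', y'⟩ h' heq
      rw [mem_primitiveReps] at h h'
      dsimp only at h h'
      simp only [Prod.mk.injEq] at heq ⊢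
      obtain ⟨hx, hy⟩ := odd_of_sq_add_two_mul_sq h.2.2
      obtain ⟨hx', hy'⟩ := odd_of_sq_add_two_mul_sq h'.2.2
      have := sq_mod_of_coprime_six hx h.1
      have := sq_mod_of_coprime_six hy h.2.1
      have := sq_mod_of_coprime_six hx' h'.1
      have := sq_mod_of_coprime_six hy' h'.2.1
      rw [← Nat.pow_left_inj two_ne_zero, ← Nat.pow_left_inj (a := y) two_ne_zero]
      omega
    · rintro ⟨a, b⟩ h
      simp only [mem_filter, HasAntidiagonal.mem_antidiagonal] at h
      obtain ⟨hab, ⟨x, hx, hxa⟩, hb, y, hy, hyb⟩ := h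
      refine ⟨(x, y), mem_primitiveReps.2 ⟨hx, hy, ?_⟩, ?_⟩
      · dsimp only
        omega
      · simp only [Prod.mk.injEq]
        omega
  have h2 : (evenReps (8 * n + 1)).card = ((antidiagonal n).filter fun a =>
      (3 ∣ a.1 ∧ ∃ x, ¬ 3 ∣ x ∧ x ^ 2 = 24 * (a.1 / 3) + 1) ∧
        ∃ m, m ^ 2 = a.2 ∧ (m = 0 ∨ ¬ 3 ∣ m)).card := by
    refine card_bij (fun p _ => (3 * (p.1 ^ 2 / 24), p.2 ^ 2)) ?_ ?_ ?_
    · rintro ⟨x, m⟩ h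
      rw [mem_evenReps] at h
      obtain ⟨hx, hm, h⟩ := h
      dsimp only at hx hm h
      have := sq_mod_of_coprime_six (odd_of_sq_mod_two (by omega)) hx
      simp only [mem_filter, HasAntidiagonal.mem_antidiagonal]
      exact ⟨by omega, ⟨by omega, x, hx, by omega⟩, m, rfl, hm⟩
    · rintro ⟨x, m⟩ h ⟨x', m'⟩ h' heq
      rw [mem_evenReps] at h h'
      dsimp only at h h'
      simp only [Prod.mk.injEq] at heq ⊢
      rw [← Nat.pow_left_inj two_ne_zero, ← Nat.pow_left_inj (a := m) two_ne_zero]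
      omega
    · rintro ⟨a, b⟩ h
      simp only [mem_filter, HasAntidiagonal.mem_antidiagonal] at h
      obtain ⟨hab, ⟨ha, x, hx, hxa⟩, m, rfl, hm⟩ := h
      refine ⟨(x, m), mem_evenReps.2 ⟨hx, hm, ?_⟩, ?_⟩
      · dsimp only
        omega
      · simp only [Prod.mk.injEq, and_true]
        omega
  rw [← h1, ← h2, card_primitiveReps_eq (by omega)]

lemma expand_two_pow (n : ℕ) (f : PowerSeries (ZMod 2)) :
    expand (2 ^ n) (pow_ne_zero n two_ne_zero) f = f ^ 2 ^ n := by
  have h := MvPowerSeries.map_iterateFrobenius_expand (R := ZMod 2) 2 two_ne_zero f n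
  have hid : iterateFrobenius (ZMod 2) 2 n = RingHom.id _ :=
    RingHom.ext fun x => by rw [iterateFrobenius_def, ZMod.pow_card_pow, RingHom.id_apply]
  rwa [hid, MvPowerSeries.map_id] at h

lemma continuous_expand {R : Type*} [CommRing R] [TopologicalSpace R] (k : ℕ) (hk : k ≠ 0) :
    Continuous (expand (R := R) k hk) := by
  rw [continuous_iff_continuousAt]
  intro f
  rw [ContinuousAt, tendsto_iff_coeff_tendsto]
  intro n
  simp only [coeff_expand]
  split_ifs
  · exact (continuous_coeff R _).tendsto f
  · exact tendsto_const_nhds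

lemma hasProd_ite_dvd {R : Type*} [CommRing R] [TopologicalSpace R] (k : ℕ) (hk : k ≠ 0) :
    HasProd (fun i : ℕ => if k ∣ i + 1 then 1 - (X : PowerSeries R) ^ (i + 1) else 1)
      (expand k hk (pentagonalSeries R)) := by
  have h := (hasProd_one_sub_X_pow R).map (expand k hk) (continuous_expand k hk)
  have hinj : Function.Injective fun i : ℕ => k * (i + 1) - 1 := by
    intro i j hij
    have hi := Nat.mul_pos (Nat.pos_of_ne_zero hk) (Nat.add_one_pos i)
    have hj := Nat.mul_pos (Nat.pos_of_ne_zero hk) (Nat.add_one_pos j)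
    have hij' : k * (i + 1) = k * (j + 1) := by dsimp only at hij; omega
    simpa [hk] using hij'
  rw [← hinj.hasProd_iff]
  · convert h using 1
    funext i
    have := Nat.mul_pos (Nat.pos_of_ne_zero hk) (Nat.add_one_pos i)
    have hi : k * (i + 1) - 1 + 1 = k * (i + 1) := by omega
    simp [hi, pow_mul]
  · intro i hi
    rw [if_neg]
    rintro ⟨j, hj⟩
    refine hi ⟨j - 1, ?_⟩
    rcases j with _ | j
    · simp at hj
    · simp [← hj]

lemma tsum_nat_mul_pow_mul {R : Type*} [CommRing R] [TopologicalSpace R] [IsTopologicalRing R]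
    [T2Space R] {x : PowerSeries R} (hx : constantCoeff x = 0)
    (hs : Summable fun j : ℕ => ((j + 1 : ℕ) : R) • x ^ (j + 1)) :
    (∑' j : ℕ, ((j + 1 : ℕ) : R) • x ^ (j + 1)) * (1 - x) ^ 2 = x := by
  have hg := summable_pow_of_constantCoeff_eq_zero hx
  have hg1 := tsum_pow_mul_one_sub_of_constantCoeff_eq_zero hx
  set S := ∑' j : ℕ, ((j + 1 : ℕ) : R) • x ^ (j + 1) with hS
  have hshift : S = x + ∑' j : ℕ, (x * (((j + 1 : ℕ) : R) • x ^ (j + 1)) + x ^ 2 * x ^ j) := by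
    rw [hS, hs.tsum_eq_zero_add]
    congr 1
    · simp
    · refine tsum_congr fun j => ?_
      push_cast
      rw [add_smul _ (1 : R), one_smul, mul_smul_comm]
      ring_nf
  rw [(hs.mul_left x).tsum_add (hg.mul_left _), hs.tsum_mul_left, hg.tsum_mul_left, ← hS] at hshift
  linear_combination (1 - x) * hshift + x ^ 2 * hg1

/-- The generating function of `PD k` modulo `2`. -/
noncomputable def PDSeries (k : ℕ) : PowerSeries (ZMod 2) :=
  Nat.Partition.genFun fun s c => if k ∣ s then 0 else (c : ZMod 2)

lemma coeff_PDSeries (k n : ℕ) : (PDSeries k).coeff n = PD k n := by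
  rw [PDSeries, Nat.Partition.coeff_genFun, PD, Nat.cast_sum]
  refine sum_congr rfl fun p _ => ?_
  rw [Finsupp.prod, Multiset.toFinsupp_support]
  simp only [Multiset.toFinsupp_apply]
  split_ifs with h
  · push_cast
    refine prod_congr rfl fun s hs => if_neg (h s (Multiset.mem_toFinset.1 hs))
  · push Not at h
    obtain ⟨s, hs, hk⟩ := h
    rw [Nat.cast_zero]
    exact prod_eq_zero (Multiset.mem_toFinset.2 hs) (if_pos hk)

lemma one_add_tsum_mul (k i : ℕ) :
    (1 + ∑' j : ℕ, (if k ∣ i + 1 then 0 else ((j + 1 : ℕ) : ZMod 2)) •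
      (X : PowerSeries (ZMod 2)) ^ ((i + 1) * (j + 1))) * (1 - X ^ (i + 1)) ^ 3 *
      expand 3 three_ne_zero (if k ∣ i + 1 then 1 - X ^ (i + 1) else 1) =
    expand 3 three_ne_zero (1 - X ^ (i + 1)) * (if k ∣ i + 1 then 1 - X ^ (i + 1) else 1) ^ 3 := by
  split_ifs with h
  · simp
    ring_nf
  · have hs := Nat.Partition.summable_genFun_term (fun _ c => (c : ZMod 2)) i
    simp only [pow_mul] at hs ⊢
    have := tsum_nat_mul_pow_mul (by simp) hs
    have h2 : (2 : PowerSeries (ZMod 2)) = 0 := by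
      rw [← map_ofNat C, show (OfNat.ofNat 2 : ZMod 2) = 0 from rfl, map_zero]
    simp only [map_one, map_sub, map_pow, expand_X, ← pow_mul, mul_comm 3 (i + 1)] at this ⊢
    simp only [pow_mul] at this ⊢
    set x := (X : PowerSeries (ZMod 2)) ^ (i + 1)
    linear_combination (1 - x) * this - (x - x ^ 2) * h2

lemma PDSeries_mul (k : ℕ) (hk : k ≠ 0) :
    PDSeries k * pentagonalSeries (ZMod 2) ^ 3 *
        expand 3 three_ne_zero (expand k hk (pentagonalSeries (ZMod 2))) =
      expand 3 three_ne_zero (pentagonalSeries (ZMod 2)) *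
        expand k hk (pentagonalSeries (ZMod 2)) ^ 3 := by
  have hc := continuous_expand (R := ZMod 2) 3 three_ne_zero
  have hF := hasProd_one_sub_X_pow (ZMod 2)
  have hE := hasProd_ite_dvd (R := ZMod 2) k hk
  have hP := Nat.Partition.hasProd_genFun fun s c => if k ∣ s then 0 else (c : ZMod 2)
  have hF3 := hF.map (expand 3 three_ne_zero) hc
  have hE3 := hE.map (expand 3 three_ne_zero) hc
  have hL := (hP.mul ((hF.mul hF).mul hF)).mul hE3
  have hR := hF3.mul ((hE.mul hE).mul hE)
  rw [pow_three', pow_three']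
  refine hL.unique ?_
  refine hR.congr_fun fun i => ?_
  simpa only [pow_three', Function.comp_apply] using one_add_tsum_mul k i

lemma squareSeries_ne_zero : squareSeries ≠ 0 := by
  intro h
  have := congrArg (coeff 0) h
  rw [squareSeries, coeff_mk, if_pos ⟨0, by simp⟩] at this
  simp at this

lemma pentagonalSeries_ne_zero : pentagonalSeries (ZMod 2) ≠ 0 := by
  intro h
  have := congrArg (coeff (pentagonal 0)) h
  simp at this

lemma expand_ne_zero {f : PowerSeries (ZMod 2)} (k : ℕ) (hk : k ≠ 0) (hf : f ≠ 0) :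
    expand k hk f ≠ 0 := by
  contrapose! hf with h
  ext n
  rw [← coeff_expand_mul k hk, h, map_zero, map_zero]

lemma expand_two (f : PowerSeries (ZMod 2)) : expand 2 two_ne_zero f = f ^ 2 := by
  simpa using expand_two_pow 1 f

lemma PDSeries_mul_squareSeries (k : ℕ) (hk : k ≠ 0) :
    PDSeries k * squareSeries = expand k hk squareSeries := by
  have h := PDSeries_mul k hk
  have hB := pentagonalSeries_mul_expand_two
  rw [expand_two, ← pow_succ'] at hB
  have hBk := congrArg (expand k hk) hB
  have hcomm : expand k hk (expand 3 three_ne_zero (pentagonalSeries (ZMod 2))) =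
      expand 3 three_ne_zero (expand k hk (pentagonalSeries (ZMod 2))) := by
    simp only [← expand_mul, mul_comm k 3]
  rw [map_mul, map_pow, hcomm] at hBk
  have h0 := mul_ne_zero
    (expand_ne_zero 3 three_ne_zero (expand_ne_zero k hk pentagonalSeries_ne_zero))
    (expand_ne_zero 3 three_ne_zero pentagonalSeries_ne_zero)
  apply mul_right_cancel₀ h0
  linear_combination h - PDSeries k *
    expand 3 three_ne_zero (expand k hk (pentagonalSeries (ZMod 2))) * hB +
    expand 3 three_ne_zero (pentagonalSeries (ZMod 2)) * hBk

lemma PDSeries_eq (m : ℕ) : PDSeries (2 ^ (m + 1)) =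
    squareSeries * expand 2 two_ne_zero (squareSeries ^ (2 ^ m - 1)) := by
  have h := PDSeries_mul_squareSeries (2 ^ (m + 1)) (by positivity)
  rw [expand_two_pow] at h
  rw [expand_two, ← pow_mul, ← pow_succ']
  apply mul_right_cancel₀ squareSeries_ne_zero
  rw [h, ← pow_succ]
  have := Nat.one_le_two_pow (n := m)
  congr 1
  rw [pow_succ]
  omega

lemma coeff_squareSeries_two_mul (n : ℕ) :
    squareSeries.coeff (2 * n) = (expand 2 two_ne_zero squareSeries).coeff n := by
  rw [coeff_expand, squareSeries, coeff_mk, coeff_mk, ← ite_and]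
  congr 1
  rw [eq_iff_iff]
  constructor
  · rintro ⟨m, h, hm⟩
    obtain ⟨t, rfl⟩ : 2 ∣ m := Nat.prime_two.dvd_of_dvd_pow ⟨n, h⟩
    have hn : n = 2 * t ^ 2 := by linarith
    exact ⟨⟨_, hn⟩, t, by omega, by omega⟩
  · rintro ⟨⟨t, rfl⟩, m, h, hm⟩
    refine ⟨2 * m, ?_, by omega⟩
    rw [mul_pow, h]
    omega

lemma coeff_mul_expand_two (f g : PowerSeries (ZMod 2)) (n : ℕ) :
    (f * expand 2 two_ne_zero g).coeff (2 * n) =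
      (mk (fun i => f.coeff (2 * i)) * g).coeff n := by
  rw [coeff_mul, coeff_mul]
  symm
  refine sum_of_injOn (fun a => (2 * a.1, 2 * a.2)) ?_ ?_ ?_ ?_
  · rintro ⟨a, b⟩ - ⟨a', b'⟩ - h
    simpa using h
  · rintro ⟨a, b⟩ h
    simp at h ⊢
    omega
  · rintro ⟨a, b⟩ h h'
    rw [coeff_expand_of_not_dvd, mul_zero]
    rintro ⟨t, ht⟩
    refine h' ⟨(n - t, t), ?_⟩
    simp at h ⊢
    omega
  · rintro ⟨a, b⟩ -
    rw [coeff_mk, coeff_expand_mul]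

lemma coeff_two_mul_PDSeries (m n : ℕ) : (PDSeries (2 ^ (m + 1))).coeff (2 * n) =
    (squareSeries * expand (2 ^ m) (by positivity) squareSeries).coeff n := by
  have hmk : mk (fun i => squareSeries.coeff (2 * i)) = squareSeries ^ 2 := by
    ext i
    rw [coeff_mk, coeff_squareSeries_two_mul, expand_two]
  rw [PDSeries_eq, coeff_mul_expand_two, hmk, expand_two_pow, ← pow_add, ← pow_succ']
  have := Nat.one_le_two_pow (n := m)
  congr 2
  omega

theorem stmt_2 (ℓ s : ℕ) (hℓ : 3 ≤ ℓ) (hs : s < 2 ^ (ℓ - 1))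
    (hnr : ¬ ∃ x : ZMod (2 ^ (ℓ - 1)), x ^ 2 = (s : ZMod (2 ^ (ℓ - 1)))) :
    ∀ n : ℕ, PD (2 ^ ℓ) (2 ^ ℓ * n + 2 * s) % 2 = 0 := by
  intro n
  obtain ⟨m, rfl⟩ : ∃ m, ℓ = m + 1 := ⟨ℓ - 1, by omega⟩
  rw [Nat.add_sub_cancel] at hnr
  rw [← Nat.even_iff, ← ZMod.natCast_eq_zero_iff_even, ← coeff_PDSeries,
    show 2 ^ (m + 1) * n + 2 * s = 2 * (2 ^ m * n + s) by ring, coeff_two_mul_PDSeries, coeff_mul]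
  refine sum_eq_zero fun ⟨a, b⟩ hab => ?_
  rw [HasAntidiagonal.mem_antidiagonal] at hab
  rw [coeff_expand]
  split_ifs with hb
  · obtain ⟨t, rfl⟩ := hb
    rw [squareSeries, coeff_mk, if_neg, zero_mul]
    rintro ⟨x, rfl, -⟩
    refine hnr ⟨x, ?_⟩
    have := congrArg (Nat.cast : ℕ → ZMod (2 ^ m)) hab
    have h0 : (2 : ZMod (2 ^ m)) ^ m = 0 := by exact_mod_cast ZMod.natCast_self (2 ^ m)
    simpa [h0] using this
  · rw [mul_zero]
end

section
/- Let j ≥ 1 and let r be an integer with 0 ≤ r < 2^j. If PD_{2^j}(2^j n + r) ≡ 0 (mod 2) holds for all integers n ≥ 0, then for every ℓ ≥ j, PD_{2^ℓ}(2^j n + r) ≡ 0 (mod 2) holds for all integers n ≥ 0. -/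
open scoped PowerSeries.WithPiTopology in
/-- The generating function of weighted partitions factors according to a predicate on the
parts. -/
theorem Nat.Partition.genFun_mul_genFun_not (P : ℕ → Prop) [DecidablePred P] (f : ℕ → ℕ → ℕ) :
    genFun (fun i c ↦ if P i then 0 else f i c) * genFun (fun i c ↦ if P i then f i c else 0) =
      genFun f := by
  refine ((hasProd_genFun _).mul (hasProd_genFun _)).unique ?_
  convert hasProd_genFun f using 2 with i
  by_cases h : P (i + 1) <;> simp [h, PowerSeries.smul_eq_C_mul]

/-- If the weight is supported on parts divisible by `d`, then so is the generating function. -/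
theorem Nat.Partition.coeff_genFun_eq_zero_of_not_dvd (d n : ℕ) (f : ℕ → ℕ → ℕ) (h : ¬ d ∣ n) :
    (genFun fun i c ↦ if d ∣ i then f i c else 0).coeff n = 0 := by
  rw [coeff_genFun]
  refine Finset.sum_eq_zero fun p _ ↦ ?_
  obtain ⟨s, hs, hds⟩ : ∃ s ∈ p.parts, ¬ d ∣ s := by
    contrapose! h
    exact p.parts_sum ▸ Multiset.dvd_sum h
  exact Finset.prod_eq_zero (i := s) (by simpa using hs) (by simp [hds])

theorem PD_eq_coeff_genFun (k n : ℕ) :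
    PD k n = (Nat.Partition.genFun fun i c ↦ if k ∣ i then 0 else c).coeff n := by
  rw [PD, Nat.Partition.coeff_genFun]
  refine Finset.sum_congr rfl fun p _ ↦ ?_
  simp only [Finsupp.prod, Multiset.toFinsupp_support, Multiset.toFinsupp_apply]
  split_ifs with h
  · exact Finset.prod_congr rfl fun s hs ↦ by simp [h s (by simpa using hs)]
  · push Not at h
    obtain ⟨s, hs, hks⟩ := h
    exact (Finset.prod_eq_zero (i := s) (by simpa using hs) (by simp [hks])).symm

/-- If `d ∣ k`, splitting off the parts divisible by `d` expresses `PD k` through `PD d`. -/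
theorem PD_eq_sum_antidiagonal {d k : ℕ} (hdk : d ∣ k) (n : ℕ) :
    PD k n = ∑ x ∈ Finset.HasAntidiagonal.antidiagonal n, PD d x.1 *
      (Nat.Partition.genFun fun i c ↦ if d ∣ i then (if k ∣ i then 0 else c) else 0).coeff x.2 := by
  have hd : (fun i c : ℕ ↦ if d ∣ i then 0 else if k ∣ i then 0 else c) =
      fun i c ↦ if d ∣ i then 0 else c := by
    ext i c
    split_ifs with h₁ h₂
    exacts [rfl, absurd (hdk.trans h₂) h₁, rfl]
  simp only [PD_eq_coeff_genFun]
  rw [← Nat.Partition.genFun_mul_genFun_not (d ∣ ·), hd, PowerSeries.coeff_mul]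

theorem stmt_4 (j r : ℕ) (hj : 1 ≤ j) (hr : r < 2 ^ j)
    (H : ∀ n : ℕ, PD (2 ^ j) (2 ^ j * n + r) % 2 = 0) :
    ∀ ℓ : ℕ, j ≤ ℓ → ∀ n : ℕ, PD (2 ^ ℓ) (2 ^ j * n + r) % 2 = 0 := by
  intro ℓ hℓ n
  rw [PD_eq_sum_antidiagonal (pow_dvd_pow 2 hℓ), ← Nat.dvd_iff_mod_eq_zero]
  refine Finset.dvd_sum fun ⟨a, b⟩ hab ↦ ?_
  rw [Finset.HasAntidiagonal.mem_antidiagonal] at hab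
  by_cases hb : 2 ^ j ∣ b
  · refine Dvd.dvd.mul_right ?_ _
    have hmod : a % 2 ^ j = r := by
      obtain ⟨c, rfl⟩ := hb
      rw [← Nat.add_mul_mod_self_left a (2 ^ j) c, hab, Nat.mul_add_mod, Nat.mod_eq_of_lt hr]
    have := Nat.dvd_of_mod_eq_zero (H (a / 2 ^ j))
    rwa [← hmod, Nat.div_add_mod] at this
  · rw [Nat.Partition.coeff_genFun_eq_zero_of_not_dvd _ _ _ hb, mul_zero]
    exact dvd_zero _
end

section
/- For each integer n ≥ 0, let a_{n,2} denote the number of pairs (k_0, k_1) of nonnegative integers such that n = k_0² + 2k_1² and, for each i ∈ {0,1}, either k_i = 0 or 3 does not divide k_i. Then a_{n,2} is odd if and only if n = m k² for some nonnegative integers m, k with m dividing 6; otherwise a_{n,2} is even. -/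
/-- The integral representations `n = x² + 2y²` with `3 ∤ x + y`. -/
noncomputable def reps (n : ℕ) : Finset (ℤ × ℤ) :=
  (Finset.Icc (-(n : ℤ)) n ×ˢ Finset.Icc (-(n : ℤ)) n).filter
    fun p => p.1 ^ 2 + 2 * p.2 ^ 2 = n ∧ ¬ 3 ∣ p.1 + p.2

/-- Representatives of `reps n` up to a global sign. -/
noncomputable def posReps (n : ℕ) : Finset (ℤ × ℤ) :=
  (reps n).filter fun p => 0 < p.1 ∨ (p.1 = 0 ∧ 0 < p.2)

theorem mem_reps {n : ℕ} {p : ℤ × ℤ} :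
    p ∈ reps n ↔ p.1 ^ 2 + 2 * p.2 ^ 2 = n ∧ ¬ 3 ∣ p.1 + p.2 := by
  simp only [reps, Finset.mem_filter, Finset.mem_product, Finset.mem_Icc, and_iff_right_iff_imp]
  rintro ⟨h, -⟩
  have hx := Int.le_self_sq p.1
  have hx' := Int.le_self_sq (-p.1)
  have hy := Int.le_self_sq p.2
  have hy' := Int.le_self_sq (-p.2)
  rw [neg_sq] at hx' hy'
  refine ⟨⟨?_, ?_⟩, ?_, ?_⟩ <;> nlinarith [sq_nonneg p.1, sq_nonneg p.2]

theorem mem_posReps {n : ℕ} {p : ℤ × ℤ} :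
    p ∈ posReps n ↔ (p.1 ^ 2 + 2 * p.2 ^ 2 = n ∧ ¬ 3 ∣ p.1 + p.2) ∧
      (0 < p.1 ∨ (p.1 = 0 ∧ 0 < p.2)) := by
  rw [posReps, Finset.mem_filter, mem_reps]

theorem card_reps (n : ℕ) : (reps n).card = 2 * (posReps n).card := by
  have h : ((reps n).filter fun p => ¬ (0 < p.1 ∨ (p.1 = 0 ∧ 0 < p.2))).card =
      (posReps n).card := by
    refine Finset.card_nbij' (fun p => -p) (fun p => -p) ?_ ?_ (fun p _ => neg_neg p)
      (fun p _ => neg_neg p)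
    · rintro ⟨x, y⟩ hp
      simp only [Finset.coe_filter, Set.mem_ofPred_eq, Finset.mem_coe, mem_reps, mem_posReps,
        Prod.fst_neg, Prod.snd_neg, neg_sq] at hp ⊢
      refine ⟨⟨hp.1.1, by lia⟩, by lia⟩
    · rintro ⟨x, y⟩ hp
      simp only [Finset.coe_filter, Set.mem_ofPred_eq, Finset.mem_coe, mem_reps, mem_posReps,
        Prod.fst_neg, Prod.snd_neg, neg_sq] at hp ⊢
      refine ⟨⟨hp.1.1, by lia⟩, by lia⟩
  have := Finset.card_filter_add_card_filter_not (s := reps n)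
    (fun p => 0 < p.1 ∨ (p.1 = 0 ∧ 0 < p.2))
  rw [h] at this
  rw [← this, two_mul, posReps]

theorem three_dvd_sub_of_dvd {x y : ℤ} (h : 3 ∣ x ^ 2 + 2 * y ^ 2) (hxy : ¬ 3 ∣ x + y) :
    3 ∣ x - y := by
  have h' : 3 ∣ (x + y) * (x - y) := by
    have : (x + y) * (x - y) = x ^ 2 + 2 * y ^ 2 - 3 * y ^ 2 := by ring
    rw [this]
    exact dvd_sub h (dvd_mul_right _ _)
  exact (Int.prime_three.dvd_or_dvd h').resolve_left hxy

/-- Multiplication by `1 + √-2` identifies the representations of `n` with those of `3n`. -/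
theorem card_reps_three_mul (n : ℕ) : (reps (3 * n)).card = (reps n).card := by
  symm
  refine Finset.card_nbij' (fun p => (p.1 - 2 * p.2, p.1 + p.2))
    (fun p => ((p.1 + 2 * p.2) / 3, (p.2 - p.1) / 3)) ?_ ?_ ?_ ?_
  · rintro ⟨x, y⟩ hp
    simp only [Finset.mem_coe, mem_reps] at hp ⊢
    refine ⟨?_, by lia⟩
    push_cast
    rw [← hp.1]
    ring
  · rintro ⟨x, y⟩ hp
    simp only [Finset.mem_coe, mem_reps] at hp ⊢
    obtain ⟨h, hxy⟩ := hp
    push_cast at h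
    obtain ⟨c, hc⟩ := three_dvd_sub_of_dvd ⟨_, h⟩ hxy
    obtain rfl : x = y + 3 * c := by lia
    have h1 : (y + 3 * c + 2 * y) / 3 = y + c := by lia
    have h2 : (y - (y + 3 * c)) / 3 = -c := by lia
    rw [h1, h2]
    refine ⟨by linarith, by lia⟩
  · rintro ⟨x, y⟩ -
    ext <;> dsimp only <;> lia
  · rintro ⟨x, y⟩ hp
    simp only [Finset.mem_coe, mem_reps] at hp
    obtain ⟨h, hxy⟩ := hp
    push_cast at h
    obtain ⟨c, hc⟩ := three_dvd_sub_of_dvd ⟨_, h⟩ hxy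
    ext <;> dsimp only <;> lia

theorem card_posReps_three_mul (n : ℕ) : (posReps (3 * n)).card = (posReps n).card := by
  have := card_reps_three_mul n
  rw [card_reps, card_reps] at this
  lia

theorem Int.sq_ne_two_mul_sq {x y : ℤ} (hy : y ≠ 0) : x ^ 2 ≠ 2 * y ^ 2 := by
  intro h
  obtain ⟨c, rfl⟩ := (Int.pow_dvd_pow_iff two_ne_zero).1 (Dvd.intro_left _ h.symm)
  have hc : c ^ 2 = 2 := by
    have : y ^ 2 * c ^ 2 = y ^ 2 * 2 := by linarith
    exact mul_left_cancel₀ (pow_ne_zero 2 hy) this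
  have h1 : c < 2 := by nlinarith
  have h2 : -2 < c := by nlinarith
  interval_cases c <;> simp at hc

theorem Int.sq_emod_three (x : ℤ) : (3 ∣ x ∧ x ^ 2 % 3 = 0) ∨ (¬ 3 ∣ x ∧ x ^ 2 % 3 = 1) := by
  have h : x % 3 = 0 ∨ x % 3 = 1 ∨ x % 3 = 2 := by lia
  rcases h with h | h | h
  · exact .inl ⟨by lia, by simp [pow_two, Int.mul_emod, h]⟩
  · exact .inr ⟨by lia, by simp [pow_two, Int.mul_emod, h]⟩
  · exact .inr ⟨by lia, by simp [pow_two, Int.mul_emod, h]⟩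

theorem even_card_filter_posReps {n : ℕ} (hn : ¬ 3 ∣ n) :
    Even ((posReps n).filter fun p => p.1 ≠ 0 ∧ p.2 ≠ 0).card := by
  rw [← ZMod.natCast_eq_zero_iff_even, Finset.card_eq_sum_ones, Nat.cast_sum]
  refine Finset.sum_involution (fun p _ => (p.1, -p.2)) ?_ ?_ ?_ ?_
  · intro p _
    decide
  · rintro ⟨x, y⟩ hp -
    simp only [Finset.mem_filter] at hp
    simp only [ne_eq, Prod.mk.injEq, true_and]
    lia
  · rintro ⟨x, y⟩ hp
    simp only [Finset.mem_filter, mem_posReps, neg_sq] at hp ⊢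
    obtain ⟨⟨⟨h, -⟩, h2⟩, h3, h4⟩ := hp
    refine ⟨⟨⟨h, ?_⟩, by lia⟩, h3, by lia⟩
    rintro ⟨c, hc⟩
    have : (n : ℤ) = 3 * (c * (x - (-y)) + y ^ 2) := by
      linear_combination -h + (x + y) * hc
    lia
  · rintro ⟨x, y⟩ _
    simp

theorem card_filter_not_posReps_of_eq_sq {k : ℕ} (hk : ¬ 3 ∣ k) :
    ((posReps (k ^ 2)).filter fun p => ¬ (p.1 ≠ 0 ∧ p.2 ≠ 0)).card = 1 := by
  rw [Finset.card_eq_one]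
  refine ⟨((k : ℤ), 0), ?_⟩
  ext ⟨x, y⟩
  simp only [Finset.mem_filter, mem_posReps, Finset.mem_singleton, Prod.mk.injEq]
  push_cast
  constructor
  · rintro ⟨⟨⟨h, -⟩, h2⟩, h3⟩
    obtain rfl | rfl : x = 0 ∨ y = 0 := by lia
    · exact absurd (by linarith) (Int.sq_ne_two_mul_sq (x := k) (y := y) (by lia))
    · refine ⟨?_, rfl⟩
      exact (pow_left_inj₀ (by lia) (by lia) two_ne_zero).1 (by linarith)
  · rintro ⟨rfl, rfl⟩
    refine ⟨⟨⟨by ring, by lia⟩, by lia⟩, by lia⟩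

theorem card_filter_not_posReps_of_eq_two_mul_sq {k : ℕ} (hk : ¬ 3 ∣ k) :
    ((posReps (2 * k ^ 2)).filter fun p => ¬ (p.1 ≠ 0 ∧ p.2 ≠ 0)).card = 1 := by
  rw [Finset.card_eq_one]
  refine ⟨(0, (k : ℤ)), ?_⟩
  ext ⟨x, y⟩
  simp only [Finset.mem_filter, mem_posReps, Finset.mem_singleton, Prod.mk.injEq]
  push_cast
  constructor
  · rintro ⟨⟨⟨h, -⟩, h2⟩, h3⟩
    obtain rfl | rfl : x = 0 ∨ y = 0 := by lia
    · refine ⟨rfl, ?_⟩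
      exact (pow_left_inj₀ (by lia) (by lia) two_ne_zero).1 (by linarith)
    · exact absurd (by linarith) (Int.sq_ne_two_mul_sq (x := x) (y := k) (by lia))
  · rintro ⟨rfl, rfl⟩
    refine ⟨⟨⟨by ring, by lia⟩, by lia⟩, by lia⟩

theorem exists_dvd_six_iff {n : ℕ} (hn : ¬ 3 ∣ n) :
    (∃ m k : ℕ, m ∣ 6 ∧ n = m * k ^ 2) ↔ ∃ k : ℕ, ¬ 3 ∣ k ∧ (n = k ^ 2 ∨ n = 2 * k ^ 2) := by
  constructor
  · rintro ⟨m, k, hm, rfl⟩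
    have hk : ¬ 3 ∣ k := fun h => hn ((h.trans (dvd_pow_self k two_ne_zero)).mul_left m)
    have hm6 := Nat.le_of_dvd (by norm_num) hm
    refine ⟨k, hk, ?_⟩
    interval_cases m
    · simp at hm
    · exact .inl (one_mul _)
    · exact .inr rfl
    · exact absurd (dvd_mul_right _ _) hn
    · norm_num at hm
    · norm_num at hm
    · exact absurd (Dvd.dvd.mul_right (by norm_num) _) hn
  · rintro ⟨k, -, rfl | rfl⟩
    · exact ⟨1, k, one_dvd 6, (one_mul _).symm⟩
    · exact ⟨2, k, by norm_num, rfl⟩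

theorem exists_dvd_six_three_mul_iff (n : ℕ) :
    (∃ m k : ℕ, m ∣ 6 ∧ 3 * n = m * k ^ 2) ↔ ∃ m k : ℕ, m ∣ 6 ∧ n = m * k ^ 2 := by
  constructor
  · rintro ⟨m, k, hm, h⟩
    by_cases h3 : 3 ∣ m
    · obtain ⟨c, rfl⟩ := h3
      exact ⟨c, k, (dvd_mul_left c 3).trans hm, by linarith⟩
    · have hk : 3 ∣ k := by
        have := (Nat.prime_three.dvd_mul.1 (Dvd.intro n h)).resolve_left h3
        exact Nat.prime_three.dvd_of_dvd_pow this
      obtain ⟨c, rfl⟩ := hk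
      refine ⟨3 * m, c, ?_, by linarith⟩
      exact Nat.Coprime.mul_dvd_of_dvd_of_dvd
        ((Nat.Prime.coprime_iff_not_dvd Nat.prime_three).2 h3) (by norm_num) hm
  · rintro ⟨m, k, hm, rfl⟩
    by_cases h3 : 3 ∣ m
    · obtain ⟨c, rfl⟩ := h3
      exact ⟨c, 3 * k, (dvd_mul_left c 3).trans hm, by ring⟩
    · exact ⟨3 * m, k, Nat.Coprime.mul_dvd_of_dvd_of_dvd
        ((Nat.Prime.coprime_iff_not_dvd Nat.prime_three).2 h3) (by norm_num) hm, by ring⟩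

theorem odd_card_posReps_of_not_dvd {n : ℕ} (hn : ¬ 3 ∣ n) :
    Odd (posReps n).card ↔ ∃ m k : ℕ, m ∣ 6 ∧ n = m * k ^ 2 := by
  rw [exists_dvd_six_iff hn, ← Finset.card_filter_add_card_filter_not (s := posReps n)
    (fun p => p.1 ≠ 0 ∧ p.2 ≠ 0), Nat.odd_add', iff_true_right (even_card_filter_posReps hn)]
  constructor
  · intro h
    obtain ⟨⟨x, y⟩, hp⟩ := Finset.card_pos.1 h.pos
    simp only [Finset.mem_filter, mem_posReps] at hp
    obtain ⟨⟨⟨h, h1⟩, h2⟩, h3⟩ := hp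
    obtain rfl | rfl : x = 0 ∨ y = 0 := by lia
    · refine ⟨y.natAbs, by lia, .inr ?_⟩
      zify
      rw [sq_abs]
      linarith
    · refine ⟨x.natAbs, by lia, .inl ?_⟩
      zify
      rw [sq_abs]
      linarith
  · rintro ⟨k, hk, rfl | rfl⟩
    · rw [card_filter_not_posReps_of_eq_sq hk]
      exact odd_one
    · rw [card_filter_not_posReps_of_eq_two_mul_sq hk]
      exact odd_one

theorem odd_card_posReps {n : ℕ} (hn : 0 < n) :
    Odd (posReps n).card ↔ ∃ m k : ℕ, m ∣ 6 ∧ n = m * k ^ 2 := by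
  induction n using Nat.strong_induction_on with
  | _ n ih =>
    by_cases h : 3 ∣ n
    · obtain ⟨c, rfl⟩ := h
      rw [card_posReps_three_mul, exists_dvd_six_three_mul_iff]
      exact ih c (by lia) (by lia)
    · exact odd_card_posReps_of_not_dvd h

theorem card_eq_card_posReps {n : ℕ} (hn : 0 < n) (h3 : 3 ∣ n) :
    Nat.card {p : ℕ × ℕ // n = p.1 ^ 2 + 2 * p.2 ^ 2 ∧
      (p.1 = 0 ∨ ¬ 3 ∣ p.1) ∧ (p.2 = 0 ∨ ¬ 3 ∣ p.2)} = (posReps n).card := by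
  rw [← Nat.card_eq_finsetCard]
  symm
  refine Nat.card_congr (Equiv.ofBijective
    (fun p => ⟨(p.1.1.natAbs, p.1.2.natAbs), ?_⟩) ⟨?_, ?_⟩)
  · obtain ⟨⟨x, y⟩, hp⟩ := p
    obtain ⟨⟨h, h1⟩, h2⟩ := mem_posReps.1 hp
    dsimp only at h h1 h2 ⊢
    have := three_dvd_sub_of_dvd (by rw [h]; exact_mod_cast h3) h1
    refine ⟨?_, by lia, by lia⟩
    zify
    rw [sq_abs, sq_abs, h]
  · rintro ⟨⟨x, y⟩, hp⟩ ⟨⟨x', y'⟩, hp'⟩ heq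
    obtain ⟨⟨h, h1⟩, h2⟩ := mem_posReps.1 hp
    obtain ⟨⟨h', h1'⟩, h2'⟩ := mem_posReps.1 hp'
    dsimp only at h h1 h2 h' h1' h2'
    have := three_dvd_sub_of_dvd (by rw [h]; exact_mod_cast h3) h1
    have := three_dvd_sub_of_dvd (by rw [h']; exact_mod_cast h3) h1'
    simp only [Subtype.mk.injEq, Prod.mk.injEq] at heq ⊢
    lia
  · rintro ⟨⟨x, y⟩, h, hx, hy⟩
    dsimp only at h hx hy
    have h' : (x : ℤ) ^ 2 + 2 * (y : ℤ) ^ 2 = n := by exact_mod_cast h.symm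
    have hx3 := Int.sq_emod_three x
    have hy3 := Int.sq_emod_three y
    have hxy : ¬ 3 ∣ x ∧ ¬ 3 ∣ y := by
      by_contra hc
      have hx0 : x = 0 := by lia
      have hy0 : y = 0 := by lia
      subst hx0 hy0
      simp at h
      lia
    by_cases hd : (3 : ℤ) ∣ x + y
    · refine ⟨⟨((x : ℤ), -(y : ℤ)), mem_posReps.2 ⟨⟨?_, ?_⟩, ?_⟩⟩, ?_⟩
      · rw [neg_sq, h']
      · dsimp only
        lia
      · dsimp only
        lia
      · simp
    · exact ⟨⟨((x : ℤ), (y : ℤ)), mem_posReps.2 ⟨⟨h', hd⟩, by dsimp only; lia⟩⟩, by simp⟩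

theorem eq_zero_or_eq_zero_of_not_dvd {n x y : ℕ} (hn : ¬ 3 ∣ n) (h : n = x ^ 2 + 2 * y ^ 2)
    (hx : x = 0 ∨ ¬ 3 ∣ x) (hy : y = 0 ∨ ¬ 3 ∣ y) : x = 0 ∨ y = 0 := by
  have hx3 := Int.sq_emod_three x
  have hy3 := Int.sq_emod_three y
  zify at h
  lia

theorem Nat.sq_ne_two_mul_sq {x y : ℕ} (hy : y ≠ 0) : x ^ 2 ≠ 2 * y ^ 2 := by
  exact_mod_cast Int.sq_ne_two_mul_sq (x := x) (y := y) (by exact_mod_cast hy)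

theorem odd_card_of_not_dvd {n : ℕ} (hn : ¬ 3 ∣ n) :
    Odd (Nat.card {p : ℕ × ℕ // n = p.1 ^ 2 + 2 * p.2 ^ 2 ∧
      (p.1 = 0 ∨ ¬ 3 ∣ p.1) ∧ (p.2 = 0 ∨ ¬ 3 ∣ p.2)}) ↔
      ∃ m k : ℕ, m ∣ 6 ∧ n = m * k ^ 2 := by
  constructor
  · intro h
    obtain ⟨⟨⟨⟨x, y⟩, h, hx, hy⟩⟩, -⟩ := Nat.card_pos_iff.1 h.pos
    dsimp only at h hx hy
    rcases eq_zero_or_eq_zero_of_not_dvd hn h hx hy with rfl | rfl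
    · exact ⟨2, y, by norm_num, by simpa using h⟩
    · exact ⟨1, x, by norm_num, by simpa using h⟩
  · rw [exists_dvd_six_iff hn]
    rintro ⟨k, hk, hnk⟩
    have hk0 : k ≠ 0 := by
      rintro rfl
      simp at hk
    suffices h : Nat.card {p : ℕ × ℕ // n = p.1 ^ 2 + 2 * p.2 ^ 2 ∧
        (p.1 = 0 ∨ ¬ 3 ∣ p.1) ∧ (p.2 = 0 ∨ ¬ 3 ∣ p.2)} = 1 by
      rw [h]
      exact odd_one
    rw [Nat.card_eq_one_iff_exists]
    rcases hnk with hnk | hnk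
    · refine ⟨⟨(k, 0), by simpa using hnk, .inr hk, .inl rfl⟩, ?_⟩
      rintro ⟨⟨x, y⟩, h, hx, hy⟩
      dsimp only at h hx hy
      simp only [Subtype.mk.injEq, Prod.mk.injEq]
      rcases eq_zero_or_eq_zero_of_not_dvd hn h hx hy with rfl | rfl
      · have hy0 : y ≠ 0 := by
          rintro rfl
          simp at h
          lia
        exact absurd (by lia) (Nat.sq_ne_two_mul_sq (x := k) (y := y) hy0)
      · exact ⟨Nat.pow_left_injective two_ne_zero (by dsimp only; lia), rfl⟩
    · refine ⟨⟨(0, k), by simpa using hnk, .inl rfl, .inr hk⟩, ?_⟩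
      rintro ⟨⟨x, y⟩, h, hx, hy⟩
      dsimp only at h hx hy
      simp only [Subtype.mk.injEq, Prod.mk.injEq]
      rcases eq_zero_or_eq_zero_of_not_dvd hn h hx hy with rfl | rfl
      · exact ⟨rfl, Nat.pow_left_injective two_ne_zero (by dsimp only; lia)⟩
      · exact absurd (by lia) (Nat.sq_ne_two_mul_sq (x := x) (y := k) hk0)

theorem stmt_7 (n : ℕ) :
    Odd (Nat.card {p : ℕ × ℕ //
        n = p.1 ^ 2 + 2 * p.2 ^ 2 ∧
        (p.1 = 0 ∨ ¬ 3 ∣ p.1) ∧ (p.2 = 0 ∨ ¬ 3 ∣ p.2)}) ↔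
      ∃ m k : ℕ, m ∣ 6 ∧ n = m * k ^ 2 := by
  by_cases h3 : 3 ∣ n
  · rcases Nat.eq_zero_or_pos n with rfl | hn
    · refine iff_of_true ?_ ⟨1, 0, by norm_num, by norm_num⟩
      suffices h : Nat.card {p : ℕ × ℕ // 0 = p.1 ^ 2 + 2 * p.2 ^ 2 ∧
          (p.1 = 0 ∨ ¬ 3 ∣ p.1) ∧ (p.2 = 0 ∨ ¬ 3 ∣ p.2)} = 1 by
        rw [h]
        exact odd_one
      rw [Nat.card_eq_one_iff_exists]
      refine ⟨⟨(0, 0), by simp⟩, ?_⟩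
      rintro ⟨⟨x, y⟩, h, -⟩
      simpa using h.symm
    · rw [card_eq_card_posReps hn h3]
      exact odd_card_posReps hn
  · exact odd_card_of_not_dvd h3
end
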